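/- arXiv:2403.03969 — 7 statements merged into one kernel-verified Lean document; each statement's English description precedes it below -/
import Mathlib

section
/- Let X ⊆ ℝ^N be nonempty and ε ∈ (0,1). For each y ∈ ℝ^N let y_X̄ denote a point of the closure of X at minimal Euclidean distance from y (with y_X̄ = y when y lies in the closure of X). Suppose Φ ∈ ℝ^{m×N} provides (ε/60)-convex hull distortion for S_X, and suppose g : ℝ^N → ℝ^m satisfies, for all y ∈ ℝ^N: (1) ‖g(y)‖₂ ≤ ‖y−y_X̄‖₂, and (2) |⟨g(y), Φ(x−y_X̄)⟩ − ⟨y−y_X̄, x−y_X̄⟩| ≤ (ε/10)·‖y−y_X̄‖₂·‖x−y_X̄‖₂ for all x ∈ X. Define f : ℝ^N → ℝ^{m+1} by f(y) = (Φy, 0) if y lies in the closure of X, and f(y) = (Φy_X̄ + g(y), √(‖y−y_X̄‖₂² − ‖g(y)‖₂²)) otherwise. Then (1−ε)‖x−y‖₂ ≤ ‖f(x)−f(y)‖₂ ≤ (1+ε)‖x−y‖₂ for all x ∈ X and all y ∈ ℝ^N. -/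
open MeasureTheory ProbabilityTheory
open scoped RealInnerProductSpace

/-- The set of unit secants of `X`. -/
def unitSecants {N : ℕ} (X : Set (EuclideanSpace ℝ (Fin N))) : Set (EuclideanSpace ℝ (Fin N)) :=
  closure {u | ∃ x ∈ X, ∃ y ∈ X, x ≠ y ∧ u = ‖x - y‖⁻¹ • (x - y)}

/-- The action of an `m × N` matrix on Euclidean space. -/
noncomputable def mulVecE {m N : ℕ} (Φ : Matrix (Fin m) (Fin N) ℝ)
    (x : EuclideanSpace ℝ (Fin N)) : EuclideanSpace ℝ (Fin m) :=
  (EuclideanSpace.equiv (Fin m) ℝ).symm (Φ.mulVec ((EuclideanSpace.equiv (Fin N) ℝ) x))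

/-- `Φ` provides `η`-convex hull distortion for `S`. -/
def convexHullDistortion {m N : ℕ} (Φ : Matrix (Fin m) (Fin N) ℝ) (η : ℝ)
    (S : Set (EuclideanSpace ℝ (Fin N))) : Prop :=
  ∀ x ∈ convexHull ℝ S, |‖mulVecE Φ x‖ - ‖x‖| ≤ η

/-- The point `(u, t) ∈ ℝ^{m+1}` built from `u ∈ ℝ^m` and `t ∈ ℝ`. -/
noncomputable def pairE {m : ℕ} (u : EuclideanSpace ℝ (Fin m)) (t : ℝ) :
    EuclideanSpace ℝ (Fin (m+1)) :=
  (EuclideanSpace.equiv (Fin (m+1)) ℝ).symm (Fin.snoc ((EuclideanSpace.equiv (Fin m) ℝ) u) t)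

lemma mulVecE_sub {m N : ℕ} (Φ : Matrix (Fin m) (Fin N) ℝ) (x y : EuclideanSpace ℝ (Fin N)) :
    mulVecE Φ (x - y) = mulVecE Φ x - mulVecE Φ y := by
  simp [mulVecE, Matrix.mulVec_sub]

lemma mulVecE_smul {m N : ℕ} (Φ : Matrix (Fin m) (Fin N) ℝ) (c : ℝ)
    (x : EuclideanSpace ℝ (Fin N)) :
    mulVecE Φ (c • x) = c • mulVecE Φ x := by
  simp [mulVecE, Matrix.mulVec_smul]

lemma pairE_sub {m : ℕ} (u v : EuclideanSpace ℝ (Fin m)) (s t : ℝ) :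
    pairE u s - pairE v t = pairE (u - v) (s - t) := by
  ext i
  refine Fin.lastCases ?_ (fun j => ?_) i <;> simp [pairE]

lemma norm_pairE_sq {m : ℕ} (u : EuclideanSpace ℝ (Fin m)) (t : ℝ) :
    ‖pairE u t‖ ^ 2 = ‖u‖ ^ 2 + t ^ 2 := by
  simp [EuclideanSpace.norm_sq_eq, Fin.sum_univ_castSucc, pairE]

/-- Normalized secants from a point of `X` to a point of its closure are unit secants of `X`. -/
lemma secant_mem_unitSecants {N : ℕ} {X : Set (EuclideanSpace ℝ (Fin N))}
    {x p : EuclideanSpace ℝ (Fin N)} (hx : x ∈ X) (hp : p ∈ closure X) (hxp : x ≠ p) :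
    ‖x - p‖⁻¹ • (x - p) ∈ unitSecants X := by
  have hc : ContinuousAt (fun q : EuclideanSpace ℝ (Fin N) => ‖x - q‖⁻¹ • (x - q)) p := by
    have h : ‖x - p‖ ≠ 0 := norm_ne_zero_iff.2 (sub_ne_zero.2 hxp)
    have h1 : ContinuousAt (fun q : EuclideanSpace ℝ (Fin N) => x - q) p := by fun_prop
    exact (h1.norm.inv₀ h).smul h1
  refine mem_closure_iff_frequently.2 (hc.tendsto.frequently ?_)
  refine ((mem_closure_iff_frequently.1 hp).and_eventually
    (isOpen_ne.mem_nhds hxp.symm)).mono ?_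
  rintro q ⟨hq, hqx⟩
  exact ⟨x, hx, q, hq, fun h => hqx h.symm, rfl⟩

lemma abs_norm_mulVecE_sub_le {m N : ℕ} {Φ : Matrix (Fin m) (Fin N) ℝ} {η : ℝ}
    {X : Set (EuclideanSpace ℝ (Fin N))} (hΦ : convexHullDistortion Φ η (unitSecants X))
    {x p : EuclideanSpace ℝ (Fin N)} (hx : x ∈ X) (hp : p ∈ closure X) :
    |‖mulVecE Φ (x - p)‖ - ‖x - p‖| ≤ η * ‖x - p‖ := by
  rcases eq_or_ne x p with rfl | hxp
  · simp [mulVecE]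
  have hpos : 0 < ‖x - p‖ := norm_pos_iff.2 (sub_ne_zero.2 hxp)
  have h := hΦ _ (subset_convexHull ℝ _ (secant_mem_unitSecants hx hp hxp))
  rw [mulVecE_smul, norm_smul, norm_smul, ← mul_sub, abs_mul, norm_inv, norm_norm,
    abs_of_pos (inv_pos.2 hpos), inv_mul_le_iff₀ hpos] at h
  linarith

theorem stmt_1 {N m : ℕ} (X : Set (EuclideanSpace ℝ (Fin N))) (hX : X.Nonempty)
    (ε : ℝ) (hε : ε ∈ Set.Ioo (0 : ℝ) 1)
    (P : EuclideanSpace ℝ (Fin N) → EuclideanSpace ℝ (Fin N))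
    (hP : ∀ y, P y ∈ closure X ∧ dist y (P y) = Metric.infDist y X)
    (hPid : ∀ y ∈ closure X, P y = y)
    (Φ : Matrix (Fin m) (Fin N) ℝ)
    (hΦ : convexHullDistortion Φ (ε / 60) (unitSecants X))
    (g : EuclideanSpace ℝ (Fin N) → EuclideanSpace ℝ (Fin m))
    (hg1 : ∀ y, ‖g y‖ ≤ ‖y - P y‖)
    (hg2 : ∀ y, ∀ x ∈ X,
      |⟪g y, mulVecE Φ (x - P y)⟫ - ⟪y - P y, x - P y⟫| ≤
        (ε / 10) * ‖y - P y‖ * ‖x - P y‖)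
    (f : EuclideanSpace ℝ (Fin N) → EuclideanSpace ℝ (Fin (m + 1)))
    (hf1 : ∀ y ∈ closure X, f y = pairE (mulVecE Φ y) 0)
    (hf2 : ∀ y ∉ closure X,
      f y = pairE (mulVecE Φ (P y) + g y) (Real.sqrt (‖y - P y‖ ^ 2 - ‖g y‖ ^ 2))) :
    ∀ x ∈ X, ∀ y : EuclideanSpace ℝ (Fin N),
      (1 - ε) * ‖x - y‖ ≤ ‖f x - f y‖ ∧ ‖f x - f y‖ ≤ (1 + ε) * ‖x - y‖ := by
  obtain ⟨h0, h1⟩ := hε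
  intro x hx y
  have hΦv := abs_norm_mulVecE_sub_le hΦ hx (hP y).1
  have hfx := hf1 x (subset_closure hx)
  by_cases hy : y ∈ closure X
  · rw [hPid y hy] at hΦv
    have hn : ‖f x - f y‖ = ‖mulVecE Φ (x - y)‖ := by
      rw [← sq_eq_sq₀ (norm_nonneg _) (norm_nonneg _), hfx, hf1 y hy, pairE_sub, norm_pairE_sq,
        mulVecE_sub]
      simp
    rw [hn]
    rw [abs_le] at hΦv
    have := mul_nonneg h0.le (norm_nonneg (x - y))
    constructor <;> linarith [hΦv.1, hΦv.2]
  have hg := hg2 y x hx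
  have hd : ‖y - P y‖ ≤ ‖x - y‖ := by
    rw [← dist_eq_norm, (hP y).2, ← dist_eq_norm, dist_comm]
    exact Metric.infDist_le_dist_of_mem hx
  have hv : ‖x - P y‖ ≤ 2 * ‖x - y‖ := by
    have := norm_add_le (x - y) (y - P y)
    rw [sub_add_sub_cancel] at this
    linarith
  have hF : ‖f x - f y‖ ^ 2 = ‖mulVecE Φ (x - P y)‖ ^ 2
      - 2 * ⟪g y, mulVecE Φ (x - P y)⟫ + ‖y - P y‖ ^ 2 := by
    have hs : 0 ≤ ‖y - P y‖ ^ 2 - ‖g y‖ ^ 2 :=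
      sub_nonneg.2 (pow_le_pow_left₀ (norm_nonneg _) (hg1 y) 2)
    rw [hfx, hf2 y hy, pairE_sub, norm_pairE_sq, ← sub_sub, ← mulVecE_sub, zero_sub, neg_sq,
      Real.sq_sqrt hs, norm_sub_sq_real, real_inner_comm]
    ring
  have hD : ‖x - y‖ ^ 2 = ‖x - P y‖ ^ 2 - 2 * ⟪y - P y, x - P y⟫ + ‖y - P y‖ ^ 2 := by
    rw [← sub_sub_sub_cancel_right x y (P y), norm_sub_sq_real, real_inner_comm]
  generalize ⟪g y, mulVecE Φ (x - P y)⟫ = a at *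
  generalize ⟪y - P y, x - P y⟫ = b at *
  have hw0 := norm_nonneg (mulVecE Φ (x - P y))
  have hv0 := norm_nonneg (x - P y)
  have hd0 := norm_nonneg (y - P y)
  have hD0 := norm_nonneg (x - y)
  have hF0 := norm_nonneg (f x - f y)
  generalize ‖mulVecE Φ (x - P y)‖ = w at *
  generalize ‖x - P y‖ = v at *
  generalize ‖y - P y‖ = d at *
  generalize ‖x - y‖ = D at *
  generalize ‖f x - f y‖ = F at *
  have hdv : d * v ≤ 2 * D ^ 2 := by nlinarith [mul_le_mul hd hv hv0 hD0]
  have hvv : v ^ 2 ≤ 4 * D ^ 2 := by nlinarith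
  have hab : |a - b| ≤ ε / 5 * D ^ 2 := by
    nlinarith [mul_le_mul_of_nonneg_left hdv h0.le]
  have hww : |w ^ 2 - v ^ 2| ≤ ε / 5 * D ^ 2 := by
    have hwv : w + v ≤ 3 * v := by nlinarith [(abs_le.1 hΦv).2]
    calc |w ^ 2 - v ^ 2| = |w - v| * (w + v) := by
          rw [sq_sub_sq, abs_mul, abs_of_nonneg (add_nonneg hw0 hv0), mul_comm]
      _ ≤ (ε / 60 * v) * (3 * v) := by gcongr
      _ ≤ ε / 5 * D ^ 2 := by nlinarith [mul_le_mul_of_nonneg_left hvv h0.le]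
  rw [abs_le] at hab hww
  have hDD : 0 ≤ ε * D ^ 2 := by positivity
  have hεD : ε ^ 2 * D ^ 2 ≤ ε * D ^ 2 := by
    gcongr
    nlinarith
  constructor
  · refine (abs_le_of_sq_le_sq' ?_ hF0).2
    nlinarith
  · refine (abs_le_of_sq_le_sq' ?_ (by positivity)).2
    nlinarith [sq_nonneg (ε * D)]
end

section
/- Let X ⊆ ℝ^N be nonempty, let ε ∈ (0,1), and let y ∈ ℝ^N. Let y_X̄ be a point of the closure of X at minimal Euclidean distance from y, and define W_y := {±(x−y_X̄)/‖x−y_X̄‖₂ : x ∈ X, x ≠ y_X̄}. Suppose Φ ∈ ℝ^{m×N} provides (ε/6)-convex hull distortion for W_y. Then there exists y' ∈ ℝ^m such that (1) ‖y'‖₂ ≤ ‖y−y_X̄‖₂, and (2) |⟨y', Φ(x−y_X̄)⟩ − ⟨y−y_X̄, x−y_X̄⟩| ≤ ε·‖y−y_X̄‖₂·‖x−y_X̄‖₂ for all x ∈ X. -/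
open MeasureTheory ProbabilityTheory
open scoped RealInnerProductSpace

/-- If a linear map `L` shrinks the norm by at most `δ` on a convex set `C`, then the functional
`⟪v, ·⟫` is bounded above on `C`, up to `δ * ‖v‖`, by the pullback along `L` of a functional of
norm at most `‖v‖`. -/
theorem exists_norm_le_forall_inner_sub_le_inner_map {E F : Type*}
    [NormedAddCommGroup E] [InnerProductSpace ℝ E]
    [NormedAddCommGroup F] [InnerProductSpace ℝ F] [CompleteSpace F]
    (L : E →ₗ[ℝ] F) {C : Set E} (hC : Convex ℝ C) {δ : ℝ}
    (hL : ∀ w ∈ C, ‖w‖ - δ ≤ ‖L w‖) (v : E) :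
    ∃ z : F, ‖z‖ ≤ ‖v‖ ∧ ∀ w ∈ C, ⟪v, w⟫ - δ * ‖v‖ ≤ ⟪z, L w⟫ := by
  rcases C.eq_empty_or_nonempty with rfl | ⟨w₀, hw₀⟩
  · exact ⟨0, by simp, by simp⟩
  let A : Set (F × ℝ) := {p | ‖v‖ * ‖p.1‖ < p.2}
  let B : Set (F × ℝ) := (fun w => (L w, ⟪v, w⟫ - δ * ‖v‖)) '' C
  have hA : Convex ℝ A := by
    rintro ⟨z₁, t₁⟩ h₁ ⟨z₂, t₂⟩ h₂ a b ha hb hab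
    simp only [A, Set.mem_ofPred_eq, Prod.smul_mk, Prod.mk_add_mk, smul_eq_mul] at h₁ h₂ ⊢
    have hn : ‖a • z₁ + b • z₂‖ ≤ a * ‖z₁‖ + b * ‖z₂‖ := by
      refine (norm_add_le _ _).trans_eq ?_
      rw [norm_smul, norm_smul, Real.norm_of_nonneg ha, Real.norm_of_nonneg hb]
    have hm := mul_le_mul_of_nonneg_left hn (norm_nonneg v)
    rcases ha.eq_or_lt with rfl | ha
    · obtain rfl : b = 1 := by linarith
      linarith
    · have := mul_lt_mul_of_pos_left h₁ ha
      have := mul_le_mul_of_nonneg_left h₂.le hb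
      linarith
  have hAo : IsOpen A := isOpen_lt (by fun_prop) (by fun_prop)
  have hB : Convex ℝ B := by
    rintro _ ⟨w₁, h₁, rfl⟩ _ ⟨w₂, h₂, rfl⟩ a b ha hb hab
    refine ⟨a • w₁ + b • w₂, hC h₁ h₂ ha hb hab, ?_⟩
    ext
    · simp
    · simp only [inner_add_right, inner_smul_right, Prod.smul_mk, Prod.mk_add_mk, smul_eq_mul]
      linear_combination δ * ‖v‖ * hab
  have hAB : Disjoint A B := by
    rw [Set.disjoint_right]
    rintro _ ⟨w, hw, rfl⟩ h
    simp only [A, Set.mem_ofPred_eq] at h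
    have := mul_le_mul_of_nonneg_left (hL w hw) (norm_nonneg v)
    have := real_inner_le_norm v w
    linarith
  obtain ⟨f, u, hfA, hfB⟩ := geometric_hahn_banach_open hA hAo hB hAB
  have hf (z : F) (t : ℝ) : f (z, t) = f (z, 0) + t * f (0, 1) := by
    rw [← smul_eq_mul, ← map_smul, ← map_add]
    simp
  have hsmul (s : ℝ) (z : F) : f (s • z, 0) = s * f (z, 0) := by
    rw [← smul_eq_mul, ← map_smul]
    simp
  -- On the cone A the upper bound u can be replaced by 0.
  have hcone (z : F) (t : ℝ) (h : ‖v‖ * ‖z‖ < t) : f (z, t) ≤ 0 := by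
    by_contra! hpos
    have hu : 0 < u := hpos.trans (hfA (z, t) h)
    have hs : 0 < u / f (z, t) := div_pos hu hpos
    have hmem : (u / f (z, t)) • (z, t) ∈ A := by
      simp only [A, Set.mem_ofPred_eq, Prod.smul_mk, smul_eq_mul, norm_smul,
        Real.norm_of_nonneg hs.le]
      have := mul_lt_mul_of_pos_left h hs
      linarith
    have := hfA _ hmem
    rw [map_smul, smul_eq_mul, div_mul_cancel₀ _ hpos.ne'] at this
    exact lt_irrefl _ this
  have hu : 0 ≤ u := by
    refine le_of_forall_pos_lt_add fun e he => ?_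
    have hk : 0 < |f (0, 1)| + 1 := by positivity
    have ht : 0 < e / (|f (0, 1)| + 1) := div_pos he hk
    have h := hfA (0, e / (|f (0, 1)| + 1)) (by simpa [A] using ht)
    have h0 : f ((0 : F), (0 : ℝ)) = 0 := map_zero f
    rw [hf, h0] at h
    have h1 := mul_le_mul_of_nonneg_left (neg_abs_le (f (0, 1))) ht.le
    have h2 : e / (|f (0, 1)| + 1) * (|f (0, 1)| + 1) = e := div_mul_cancel₀ _ hk.ne'
    linarith
  have hle : f (0, 1) ≤ 0 := hcone 0 1 (by simp)
  have hneg : f (0, 1) < 0 := by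
    refine lt_of_le_of_ne hle fun h0 => ?_
    have h1 := hfB _ ⟨w₀, hw₀, rfl⟩
    have h2 := hfA (L w₀, ‖v‖ * ‖L w₀‖ + 1) (by simp [A])
    simp only [hf (L w₀) (_ - _)] at h1
    rw [hf] at h2
    rw [h0] at h1 h2
    linarith
  let g : StrongDual ℝ F := (-f (0, 1))⁻¹ • f.comp (ContinuousLinearMap.inl ℝ F ℝ)
  have hg (z : F) : g z = (-f (0, 1))⁻¹ * f (z, 0) := by simp [g]
  have hgle (z : F) : g z ≤ ‖v‖ * ‖z‖ := by
    refine le_of_forall_gt_imp_ge_of_dense fun t ht => ?_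
    have := hcone z t ht
    rw [hf] at this
    rw [hg, inv_mul_le_iff₀ (neg_pos.2 hneg)]
    linarith
  refine ⟨(InnerProductSpace.toDual ℝ F).symm g, ?_, fun w hw => ?_⟩
  · rw [LinearIsometryEquiv.norm_map]
    refine g.opNorm_le_bound (norm_nonneg v) fun z => abs_le.2 ⟨?_, hgle z⟩
    have := hgle (-z)
    rw [map_neg, norm_neg] at this
    linarith
  · rw [InnerProductSpace.toDual_symm_apply, hg, le_inv_mul_iff₀ (neg_pos.2 hneg)]
    have := hfB _ ⟨w, hw, rfl⟩
    simp only [hf (L w) (_ - _)] at this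
    linarith

theorem stmt_2 {N m : ℕ} (X : Set (EuclideanSpace ℝ (Fin N))) (hX : X.Nonempty)
    (ε : ℝ) (hε : ε ∈ Set.Ioo (0 : ℝ) 1) (y yb : EuclideanSpace ℝ (Fin N))
    (hyb1 : yb ∈ closure X) (hyb2 : dist y yb = Metric.infDist y X)
    (Φ : Matrix (Fin m) (Fin N) ℝ)
    (hΦ : convexHullDistortion Φ (ε / 6)
      {u | ∃ x ∈ X, x ≠ yb ∧
        (u = ‖x - yb‖⁻¹ • (x - yb) ∨ u = -(‖x - yb‖⁻¹ • (x - yb)))}) :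
    ∃ y' : EuclideanSpace ℝ (Fin m), ‖y'‖ ≤ ‖y - yb‖ ∧
      ∀ x ∈ X, |⟪y', mulVecE Φ (x - yb)⟫ - ⟪y - yb, x - yb⟫| ≤
        ε * ‖y - yb‖ * ‖x - yb‖ := by
  set W := {u | ∃ x ∈ X, x ≠ yb ∧
    (u = ‖x - yb‖⁻¹ • (x - yb) ∨ u = -(‖x - yb‖⁻¹ • (x - yb)))} with hW
  obtain ⟨z, hz, hzW⟩ := exists_norm_le_forall_inner_sub_le_inner_map
    (Matrix.toEuclideanLin Φ) (convex_convexHull ℝ W) (δ := ε / 6)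
    (fun w hw => by
      have := (abs_le.1 (hΦ w hw)).1
      change -(ε / 6) ≤ ‖Matrix.toEuclideanLin Φ w‖ - ‖w‖ at this
      linarith) (y - yb)
  refine ⟨z, hz, fun x hx => ?_⟩
  change |⟪z, Matrix.toEuclideanLin Φ (x - yb)⟫ - _| ≤ _
  rcases eq_or_ne x yb with rfl | hne
  · simp
  have hn : 0 < ‖x - yb‖ := norm_pos_iff.2 (sub_ne_zero.2 hne)
  have h1 := hzW _ (subset_convexHull ℝ W ⟨x, hx, hne, Or.inl rfl⟩)
  have h2 := hzW _ (subset_convexHull ℝ W ⟨x, hx, hne, Or.inr rfl⟩)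
  simp only [map_neg, map_smul, inner_neg_right, inner_smul_right] at h1 h2
  have h1' := mul_le_mul_of_nonneg_left h1 hn.le
  have h2' := mul_le_mul_of_nonneg_left h2 hn.le
  simp only [mul_sub, mul_neg, mul_inv_cancel_left₀ hn.ne'] at h1' h2'
  have hpos : 0 ≤ ε * ‖y - yb‖ * ‖x - yb‖ := by
    have := hε.1
    positivity
  rw [abs_le]
  constructor <;> linarith
end

section
/- Let x₁,…,xₙ be nonzero points in ℝ^N and let ε > 0. Suppose Φ ∈ ℝ^{m×N} provides ε-convex hull distortion for the finite set V = {±xᵢ/‖xᵢ‖₂ : i = 1,…,n}. Then for any y ∈ ℝ^N there exists y' ∈ ℝ^m such that ‖y'‖₂ ≤ ‖y‖₂ and |⟨y', Φxᵢ⟩ − ⟨y, xᵢ⟩| ≤ ε·‖y‖₂·‖xᵢ‖₂ for every i = 1,…,n. -/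
open MeasureTheory ProbabilityTheory
open scoped RealInnerProductSpace

/-- If `T` shrinks the norm on a compact convex set `K` by at most `ε`, then the functional
`⟪y, ·⟫` is dominated on `K`, up to `ε * ‖y‖`, by `⟪y', T ·⟫` for some `y'` with `‖y'‖ ≤ ‖y‖`. -/
theorem exists_norm_le_inner_sub_inner_le {E F : Type*}
    [NormedAddCommGroup E] [InnerProductSpace ℝ E]
    [NormedAddCommGroup F] [InnerProductSpace ℝ F] [ProperSpace F]
    (T : E →L[ℝ] F) {K : Set E} (hKc : Convex ℝ K) (hK : IsCompact K) {ε : ℝ}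
    (hT : ∀ u ∈ K, ‖u‖ - ‖T u‖ ≤ ε) (y : E) :
    ∃ y' : F, ‖y'‖ ≤ ‖y‖ ∧ ∀ u ∈ K, ⟪y, u⟫ - ⟪y', T u⟫ ≤ ε * ‖y‖ := by
  obtain rfl | hne := K.eq_empty_or_nonempty
  · exact ⟨0, by simp, by simp⟩
  have hB : Convex ℝ (Metric.closedBall (0 : F) ‖y‖) := convex_closedBall 0 ‖y‖
  obtain ⟨a, ha, b, hb, hab⟩ := Sion.exists_isSaddlePointOn' (β := ℝ)
    (f := fun (z : F) (u : E) ↦ ⟪y, u⟫ - ⟪z, T u⟫)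
    (X := Metric.closedBall (0 : F) ‖y‖) (Y := K)
    ⟨0, by simp⟩ (isCompact_closedBall 0 ‖y‖)
    (fun u _ ↦ (Continuous.lowerSemicontinuous (by fun_prop)).lowerSemicontinuousOn _)
    (fun u _ ↦ by
      refine ConvexOn.quasiconvexOn ⟨hB, fun z _ w _ s t _ _ hst ↦ le_of_eq ?_⟩
      simp only [inner_add_left, real_inner_smul_left, smul_eq_mul]
      linear_combination (-⟪y, u⟫) * hst)
    hKc hK
    (fun z _ ↦ (Continuous.upperSemicontinuous (by fun_prop)).upperSemicontinuousOn _)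
    (fun z _ ↦ by
      refine ConcaveOn.quasiconcaveOn ⟨hKc, fun u _ v _ s t _ _ _ ↦ le_of_eq ?_⟩
      simp only [map_add, map_smul, inner_add_right, real_inner_smul_right, smul_eq_mul]
      ring)
    hB hne
  refine ⟨a, by simpa using ha, fun u hu ↦ ?_⟩
  have hz : ‖(‖y‖ * ‖T b‖⁻¹) • T b‖ ≤ ‖y‖ := by
    rw [norm_smul, Real.norm_of_nonneg (by positivity), mul_assoc]
    exact mul_le_of_le_one_right (norm_nonneg y) inv_mul_le_one
  calc ⟪y, u⟫ - ⟪a, T u⟫ ≤ ⟪y, b⟫ - ⟪(‖y‖ * ‖T b‖⁻¹) • T b, T b⟫ :=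
        hab _ (by simpa using hz) u hu
    _ = ⟪y, b⟫ - ‖y‖ * ‖T b‖ := by
        rw [real_inner_smul_left, real_inner_self_eq_norm_sq]
        obtain h | h := eq_or_ne ‖T b‖ 0
        · simp [h]
        · field_simp
    _ ≤ ‖y‖ * ‖b‖ - ‖y‖ * ‖T b‖ := by gcongr; exact real_inner_le_norm y b
    _ ≤ ε * ‖y‖ := by
        rw [← mul_sub, mul_comm ε]
        exact mul_le_mul_of_nonneg_left (hT b hb) (norm_nonneg y)

theorem mulVecE_eq_toLpLin {m N : ℕ} (Φ : Matrix (Fin m) (Fin N) ℝ)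
    (x : EuclideanSpace ℝ (Fin N)) : mulVecE Φ x = Matrix.toLpLin 2 2 Φ x := rfl

theorem stmt_3 {N m n : ℕ} (x : Fin n → EuclideanSpace ℝ (Fin N))
    (hx : ∀ i, x i ≠ 0) (ε : ℝ) (hε : 0 < ε) (Φ : Matrix (Fin m) (Fin N) ℝ)
    (hΦ : convexHullDistortion Φ ε
      {u | ∃ i : Fin n, u = ‖x i‖⁻¹ • x i ∨ u = -(‖x i‖⁻¹ • x i)})
    (y : EuclideanSpace ℝ (Fin N)) :
    ∃ y' : EuclideanSpace ℝ (Fin m), ‖y'‖ ≤ ‖y‖ ∧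
      ∀ i : Fin n, |⟪y', mulVecE Φ (x i)⟫ - ⟪y, x i⟫| ≤ ε * ‖y‖ * ‖x i‖ := by
  set S : Set (EuclideanSpace ℝ (Fin N)) :=
    {u | ∃ i : Fin n, u = ‖x i‖⁻¹ • x i ∨ u = -(‖x i‖⁻¹ • x i)}
  have hfin : S.Finite := by
    refine ((Set.finite_range fun i ↦ ‖x i‖⁻¹ • x i).union
      (Set.finite_range fun i ↦ -(‖x i‖⁻¹ • x i))).subset ?_
    rintro u ⟨i, rfl | rfl⟩
    · exact Or.inl ⟨i, rfl⟩
    · exact Or.inr ⟨i, rfl⟩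
  obtain ⟨y', hy', h⟩ := exists_norm_le_inner_sub_inner_le
    (LinearMap.toContinuousLinearMap (Matrix.toLpLin 2 2 Φ))
    (convex_convexHull ℝ S) (hfin.isCompact_convexHull ℝ)
    (fun u hu ↦ (le_abs_self _).trans ((abs_sub_comm _ _).trans_le (hΦ u hu))) y
  refine ⟨y', hy', fun i ↦ ?_⟩
  have hpos : 0 < ‖x i‖ := norm_pos_iff.2 (hx i)
  have h₁ := h _ (subset_convexHull ℝ S ⟨i, Or.inl rfl⟩)
  have h₂ := h _ (subset_convexHull ℝ S ⟨i, Or.inr rfl⟩)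
  simp only [LinearMap.coe_toContinuousLinearMap', map_neg, map_smul, inner_neg_right,
    real_inner_smul_right, ← mul_neg, ← mul_sub, inv_mul_le_iff₀ hpos] at h₁ h₂
  rw [mulVecE_eq_toLpLin, abs_le]
  constructor <;> linarith
end

section
/- There exists a universal constant C > 0 with the following property. For every N ∈ ℕ, every finite subset X ⊆ ℝ^N with n := |X| > 1 elements, and every ε ∈ (0,1), there exist a natural number m with m ≤ C·ε^{-2}·log n and a map f : ℝ^N → ℝ^m such that (1−ε)‖x−y‖₂ ≤ ‖f(x)−f(y)‖₂ ≤ (1+ε)‖x−y‖₂ for all x ∈ X and all y ∈ ℝ^N. -/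
open MeasureTheory ProbabilityTheory
open scoped RealInnerProductSpace

/-- The sign attached to a Boolean. -/
def boolSign (b : Bool) : ℝ := if b then 1 else -1

theorem exp_sq_add_exp_sq_le (s a x : ℝ) :
    Real.exp (s * (a + x) ^ 2) + Real.exp (s * (a - x) ^ 2) ≤
      2 * Real.exp (s * a ^ 2 + s * x ^ 2 + 2 * s ^ 2 * a ^ 2 * x ^ 2) := by
  have h := Real.cosh_le_exp_half_sq (2 * s * a * x)
  have e1 : Real.exp (s * (a + x) ^ 2) =
      Real.exp (s * a ^ 2 + s * x ^ 2) * Real.exp (2 * s * a * x) := by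
    rw [← Real.exp_add]; ring_nf
  have e2 : Real.exp (s * (a - x) ^ 2) =
      Real.exp (s * a ^ 2 + s * x ^ 2) * Real.exp (-(2 * s * a * x)) := by
    rw [← Real.exp_add]; ring_nf
  have e3 : Real.exp (s * a ^ 2 + s * x ^ 2 + 2 * s ^ 2 * a ^ 2 * x ^ 2) =
      Real.exp (s * a ^ 2 + s * x ^ 2) * Real.exp ((2 * s * a * x) ^ 2 / 2) := by
    rw [← Real.exp_add]; ring_nf
  rw [e1, e2, e3, ← mul_add]
  rw [Real.cosh_eq] at h
  nlinarith [Real.exp_pos (s * a ^ 2 + s * x ^ 2)]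

theorem sum_exp_sq_signs_le (N : ℕ) (x : Fin N → ℝ) (s a : ℝ)
    (h : 8 * |s| * ∑ i, x i ^ 2 ≤ 1) :
    ∑ σ : Fin N → Bool, Real.exp (s * (a + ∑ i, boolSign (σ i) * x i) ^ 2) ≤
      2 ^ N * Real.exp ((s + 8 * s ^ 2 * ∑ i, x i ^ 2) * a ^ 2 + s * ∑ i, x i ^ 2 +
        8 * s ^ 2 * (∑ i, x i ^ 2) ^ 2) := by
  induction N generalizing a with
  | zero => simp
  | succ N ih =>
    rw [← (Fin.consEquiv (fun _ => Bool)).sum_comp, Fintype.sum_prod_type]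
    simp only [Fin.consEquiv_apply, Fin.sum_univ_succ, Fin.cons_zero, Fin.cons_succ] at h ⊢
    set V := ∑ i : Fin N, x i.succ ^ 2 with hV
    have hV0 : 0 ≤ V := Finset.sum_nonneg fun i _ => sq_nonneg _
    set y := x 0 with hy
    have hs := abs_nonneg s
    have hV1 : 8 * |s| * V ≤ 1 := by nlinarith [mul_nonneg hs (sq_nonneg y)]
    have key := fun a' => ih (fun i => x i.succ) a' hV1
    rw [← hV] at key
    have hb : ∀ b : Bool, ∑ σ : Fin N → Bool,
        Real.exp (s * (a + (boolSign b * y + ∑ i, boolSign (σ i) * x i.succ)) ^ 2) ≤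
        2 ^ N * (Real.exp (s * V + 8 * s ^ 2 * V ^ 2) *
          Real.exp ((s + 8 * s ^ 2 * V) * (a + boolSign b * y) ^ 2)) := by
      intro b
      simp only [← add_assoc]
      refine (key _).trans (le_of_eq ?_)
      rw [← Real.exp_add]; ring_nf
    rw [Fintype.sum_bool]
    refine (add_le_add (hb true) (hb false)).trans ?_
    simp only [boolSign, if_true, Bool.false_eq_true, if_false, one_mul, neg_one_mul,
      ← sub_eq_add_neg]
    rw [← mul_add, ← mul_add, pow_succ (2 : ℝ) N, mul_assoc ((2 : ℝ) ^ N) 2]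
    refine mul_le_mul_of_nonneg_left ?_ (by positivity : (0 : ℝ) ≤ 2 ^ N)
    refine (mul_le_mul_of_nonneg_left (exp_sq_add_exp_sq_le _ _ _) (Real.exp_pos _).le).trans ?_
    rw [mul_left_comm, ← Real.exp_add]
    refine mul_le_mul_of_nonneg_left (Real.exp_le_exp.2 ?_) (by norm_num)
    set c := s + 8 * s ^ 2 * V with hc
    have hc2 : c ^ 2 ≤ 4 * s ^ 2 := by
      have : |c| ≤ 2 * |s| := by
        rw [hc]
        refine (abs_add_le _ _).trans ?_
        rw [abs_of_nonneg (by positivity : 0 ≤ 8 * s ^ 2 * V), ← sq_abs s]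
        nlinarith
      nlinarith [sq_abs c, sq_abs s, abs_nonneg c]
    have h1 : 2 * c ^ 2 * a ^ 2 * y ^ 2 ≤ 8 * s ^ 2 * (a ^ 2 * y ^ 2) := by
      nlinarith [mul_nonneg (sq_nonneg a) (sq_nonneg y)]
    have h2 : 0 ≤ s ^ 2 * (V * y ^ 2) := by positivity
    have h3 : 0 ≤ s ^ 2 * (y ^ 2 * y ^ 2) := by positivity
    rw [hc] at h1 ⊢
    nlinarith

/-- The linear map given by a matrix of signs. -/
noncomputable def signMap {m N : ℕ} (ω : Fin m → Fin N → Bool) :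
    EuclideanSpace ℝ (Fin N) →ₗ[ℝ] EuclideanSpace ℝ (Fin m) :=
  Matrix.toEuclideanLin (Matrix.of fun k i => boolSign (ω k i))

theorem norm_sq_signMap {m N : ℕ} (ω : Fin m → Fin N → Bool) (x : EuclideanSpace ℝ (Fin N)) :
    ‖signMap ω x‖ ^ 2 = ∑ k, (∑ i, boolSign (ω k i) * x i) ^ 2 := by
  rw [EuclideanSpace.real_norm_sq_eq]
  simp [signMap, Matrix.toEuclideanLin, Matrix.mulVec, dotProduct]

theorem sum_exp_signMap_le (m N : ℕ) (x : EuclideanSpace ℝ (Fin N)) (s : ℝ)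
    (h : 8 * |s| * ‖x‖ ^ 2 ≤ 1) :
    ∑ ω : Fin m → Fin N → Bool, Real.exp (s * (‖signMap ω x‖ ^ 2 - m * ‖x‖ ^ 2)) ≤
      2 ^ (N * m) * Real.exp (8 * m * s ^ 2 * ‖x‖ ^ 4) := by
  have hx := EuclideanSpace.real_norm_sq_eq x
  have hrow := sum_exp_sq_signs_le N x s 0 (by rw [← hx]; exact h)
  rw [← hx] at hrow
  have hrow' : ∑ σ : Fin N → Bool, Real.exp (s * ((∑ i, boolSign (σ i) * x i) ^ 2 - ‖x‖ ^ 2)) ≤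
      2 ^ N * Real.exp (8 * s ^ 2 * ‖x‖ ^ 4) := by
    have : ∀ σ : Fin N → Bool, Real.exp (s * ((∑ i, boolSign (σ i) * x i) ^ 2 - ‖x‖ ^ 2)) =
        Real.exp (s * (0 + ∑ i, boolSign (σ i) * x i) ^ 2) * Real.exp (-(s * ‖x‖ ^ 2)) := by
      intro σ; rw [← Real.exp_add]; ring_nf
    simp_rw [this]
    rw [← Finset.sum_mul]
    refine (mul_le_mul_of_nonneg_right hrow (Real.exp_pos _).le).trans (le_of_eq ?_)
    rw [mul_assoc, ← Real.exp_add]; ring_nf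
  have hprod : ∀ ω : Fin m → Fin N → Bool,
      Real.exp (s * (‖signMap ω x‖ ^ 2 - m * ‖x‖ ^ 2)) =
      ∏ k, Real.exp (s * ((∑ i, boolSign (ω k i) * x i) ^ 2 - ‖x‖ ^ 2)) := by
    intro ω
    rw [← Real.exp_sum, norm_sq_signMap, ← Finset.mul_sum, Finset.sum_sub_distrib]
    simp
  simp_rw [hprod]
  have := Finset.prod_univ_sum (fun _ : Fin m => (Finset.univ : Finset (Fin N → Bool)))
    (fun _ σ => Real.exp (s * ((∑ i, boolSign (σ i) * x i) ^ 2 - ‖x‖ ^ 2)))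
  rw [Fintype.piFinset_univ] at this
  rw [← this, Finset.prod_const, Finset.card_univ, Fintype.card_fin]
  refine (pow_le_pow_left₀ (Finset.sum_nonneg fun _ _ => (Real.exp_pos _).le) hrow' m).trans
    (le_of_eq ?_)
  rw [mul_pow, ← pow_mul, ← Real.exp_nat_mul]; ring_nf

theorem exists_signMap_forall_lt (m N : ℕ) {J : Type*} [Fintype J]
    (y : J → EuclideanSpace ℝ (Fin N)) (s c : J → ℝ)
    (hs : ∀ j, 8 * |s j| * ‖y j‖ ^ 2 ≤ 1)
    (hsum : ∑ j, Real.exp (8 * m * s j ^ 2 * ‖y j‖ ^ 4 - c j) < 1) :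
    ∃ ω : Fin m → Fin N → Bool, ∀ j, s j * (‖signMap ω (y j)‖ ^ 2 - m * ‖y j‖ ^ 2) < c j := by
  have hlt : ∑ ω : Fin m → Fin N → Bool,
      ∑ j, Real.exp (s j * (‖signMap ω (y j)‖ ^ 2 - m * ‖y j‖ ^ 2) - c j) <
      ∑ ω : Fin m → Fin N → Bool, (1 : ℝ) := by
    rw [Finset.sum_comm]
    have hcard : ∑ ω : Fin m → Fin N → Bool, (1 : ℝ) = 2 ^ (N * m) := by
      simp [pow_mul]
    rw [hcard]
    calc _ ≤ ∑ j, 2 ^ (N * m) * Real.exp (8 * m * s j ^ 2 * ‖y j‖ ^ 4 - c j) := by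
          refine Finset.sum_le_sum fun j _ => ?_
          simp_rw [Real.exp_sub]
          rw [← Finset.sum_div, ← mul_div_assoc]
          exact div_le_div_of_nonneg_right (sum_exp_signMap_le m N (y j) (s j) (hs j))
            (Real.exp_pos _).le
      _ = 2 ^ (N * m) * ∑ j, Real.exp (8 * m * s j ^ 2 * ‖y j‖ ^ 4 - c j) :=
          (Finset.mul_sum _ _ _).symm
      _ < 2 ^ (N * m) * 1 := by gcongr
      _ = 2 ^ (N * m) := mul_one _
  obtain ⟨ω, -, hω⟩ := Finset.exists_lt_of_sum_lt hlt
  refine ⟨ω, fun j => ?_⟩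
  by_contra! hj
  have h1 : 1 ≤ Real.exp (s j * (‖signMap ω (y j)‖ ^ 2 - m * ‖y j‖ ^ 2) - c j) :=
    Real.one_le_exp (by linarith)
  have h2 := Finset.single_le_sum (f := fun j =>
    Real.exp (s j * (‖signMap ω (y j)‖ ^ 2 - m * ‖y j‖ ^ 2) - c j))
    (fun _ _ => (Real.exp_pos _).le) (Finset.mem_univ j)
  linarith

theorem exists_signMap_forall_le (m N : ℕ) {J : Type*} [Fintype J]
    (y : J → EuclideanSpace ℝ (Fin N)) (δ e : J → ℝ) (hδ0 : ∀ j, 0 < δ j) (hδ1 : ∀ j, δ j ≤ 1)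
    (he : ∀ j, |e j| = 1) (hsum : ∑ j, Real.exp (-(m * δ j ^ 2 / 32)) < 1) :
    ∃ ω : Fin m → Fin N → Bool, ∀ j,
      e j * (‖signMap ω (y j)‖ ^ 2 - m * ‖y j‖ ^ 2) ≤ δ j * m * ‖y j‖ ^ 2 := by
  have hs : ∀ j, 8 * |e j * (δ j / (16 * ‖y j‖ ^ 2))| * ‖y j‖ ^ 2 ≤ 1 := by
    intro j
    rw [abs_mul, he, one_mul, abs_of_nonneg (div_nonneg (hδ0 j).le (by positivity))]
    rcases eq_or_ne (y j) 0 with h0 | h0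
    · simp [h0]
    have hV : 0 < ‖y j‖ := by positivity
    have : 8 * (δ j / (16 * ‖y j‖ ^ 2)) * ‖y j‖ ^ 2 = δ j / 2 := by field_simp; ring
    rw [this]; linarith [hδ1 j]
  have hexp : ∀ j, 8 * m * (e j * (δ j / (16 * ‖y j‖ ^ 2))) ^ 2 * ‖y j‖ ^ 4 - m * δ j ^ 2 / 16 ≤
      -(m * δ j ^ 2 / 32) := by
    intro j
    have hm : (0 : ℝ) ≤ m * δ j ^ 2 := by positivity
    rcases eq_or_ne (y j) 0 with h0 | h0
    · simp only [h0, norm_zero]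
      norm_num
      linarith
    have hV : 0 < ‖y j‖ := by positivity
    have he2 : e j ^ 2 = 1 := by rw [← sq_abs, he, one_pow]
    rw [mul_pow, he2, one_mul]
    have : 8 * (m : ℝ) * (δ j / (16 * ‖y j‖ ^ 2)) ^ 2 * ‖y j‖ ^ 4 = m * δ j ^ 2 / 32 := by
      field_simp; ring
    rw [this]; linarith
  obtain ⟨ω, hω⟩ := exists_signMap_forall_lt m N y _ (fun j => m * δ j ^ 2 / 16) hs
    (lt_of_le_of_lt (Finset.sum_le_sum fun j _ => Real.exp_le_exp.2 (hexp j)) hsum)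
  refine ⟨ω, fun j => ?_⟩
  rcases eq_or_ne (y j) 0 with h0 | h0
  · simp [h0]
  have hV : 0 < ‖y j‖ ^ 2 := by positivity
  have h := hω j
  set V := ‖y j‖ ^ 2
  set D := ‖signMap ω (y j)‖ ^ 2 - m * V
  have hd := hδ0 j
  have h1 : e j * (δ j / (16 * V)) * D = (e j * D) * (δ j / (16 * V)) := by ring
  have h2 : m * δ j ^ 2 / 16 = (δ j * m * V) * (δ j / (16 * V)) := by field_simp
  rw [h1, h2] at h
  exact (lt_of_mul_lt_mul_right h (by positivity)).le

theorem exists_linearMap_norm_sq_bounds {m N : ℕ} (hm : 0 < m)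
    (T : Finset (EuclideanSpace ℝ (Fin N))) {η : ℝ} (hη0 : 0 < η) (hη1 : η ≤ 1)
    (hT : 4 * (T.card : ℝ) ≤ Real.exp (m * η ^ 2 / 32)) :
    ∃ A : EuclideanSpace ℝ (Fin N) →ₗ[ℝ] EuclideanSpace ℝ (Fin m),
      (∀ v ∈ T, ‖A v‖ ^ 2 ≤ (1 + η) * ‖v‖ ^ 2) ∧
      ∀ (k : ℕ) (t : Fin k → EuclideanSpace ℝ (Fin N)), (∀ j, t j ∈ T) →
        (1 - η * √k) * ‖∑ j, t j‖ ^ 2 ≤ ‖A (∑ j, t j)‖ ^ 2 := by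
  set K := ⌊1 / η ^ 2⌋₊ with hK
  have hKη : ∀ k : Fin K, η * √((k : ℕ) + 1 : ℝ) ≤ 1 := by
    intro k
    have h1 : ((k : ℕ) + 1 : ℝ) ≤ 1 / η ^ 2 := by
      have := Nat.floor_le (a := 1 / η ^ 2) (by positivity)
      have hk : ((k : ℕ) + 1 : ℝ) ≤ K := by exact_mod_cast k.2
      exact hk.trans this
    have h2 : √((k : ℕ) + 1 : ℝ) ≤ 1 / η := by
      rw [Real.sqrt_le_left (by positivity), div_pow, one_pow]; exact h1
    calc η * √((k : ℕ) + 1 : ℝ) ≤ η * (1 / η) := by gcongr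
      _ = 1 := by field_simp
  set q := Real.exp (-(m * η ^ 2 / 32)) with hq
  have hTq : T.card * q ≤ 1 / 4 := by
    rw [hq, Real.exp_neg, ← div_eq_mul_inv, div_le_iff₀ (Real.exp_pos _)]; linarith
  have hTq0 : 0 ≤ T.card * q := by positivity
  obtain ⟨ω, hω⟩ := exists_signMap_forall_le m N
    (J := T ⊕ (Σ k : Fin K, (Fin ((k : ℕ) + 1) → T)))
    (Sum.elim (fun v => v.1) (fun s => ∑ j, (s.2 j).1))
    (Sum.elim (fun _ => η) (fun s => η * √((s.1 : ℕ) + 1 : ℝ)))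
    (Sum.elim (fun _ => 1) (fun _ => -1))
    (by rintro (v | s) <;> simp only [Sum.elim_inl, Sum.elim_inr] <;> positivity)
    (by rintro (v | s)
        · simpa using hη1
        · simpa using hKη s.1)
    (by rintro (v | s) <;> simp)
    (by
      rw [Fintype.sum_sum_type, Fintype.sum_sigma]
      simp only [Sum.elim_inl, Sum.elim_inr, Finset.sum_const, Finset.card_univ,
        Fintype.card_coe, Fintype.card_pi, Finset.prod_const, Fintype.card_fin, nsmul_eq_mul]
      have hterm : ∀ k : Fin K, ((T.card ^ ((k : ℕ) + 1) : ℕ) : ℝ) *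
          Real.exp (-(m * (η * √((k : ℕ) + 1 : ℝ)) ^ 2 / 32)) ≤ 1 / 4 * (1 / 2) ^ (k : ℕ) := by
        intro k
        have e1 : Real.exp (-(m * (η * √((k : ℕ) + 1 : ℝ)) ^ 2 / 32)) = q ^ ((k : ℕ) + 1) := by
          rw [hq, ← Real.exp_nat_mul, mul_pow, Real.sq_sqrt (by positivity)]
          push_cast; ring_nf
        rw [e1]
        push_cast
        rw [← mul_pow, pow_succ, mul_comm]
        gcongr
        linarith
      have hgeo := sum_geometric_two_le K
      rw [← Fin.sum_univ_eq_sum_range (fun i => (1 / 2 : ℝ) ^ i) K] at hgeo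
      calc _ ≤ 1 / 4 + ∑ k : Fin K, 1 / 4 * (1 / 2 : ℝ) ^ (k : ℕ) :=
            add_le_add hTq (Finset.sum_le_sum fun k _ => hterm k)
        _ ≤ 1 / 4 + 1 / 4 * 2 := by rw [← Finset.mul_sum]; gcongr
        _ < 1 := by norm_num)
  have hm' : (0 : ℝ) < m := by exact_mod_cast hm
  have hA : ∀ x, ‖((√(m : ℝ))⁻¹ • signMap ω) x‖ ^ 2 = ‖signMap ω x‖ ^ 2 / m := by
    intro x
    rw [LinearMap.smul_apply, norm_smul, mul_pow, norm_inv, Real.norm_of_nonneg (by positivity),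
      inv_pow, Real.sq_sqrt hm'.le, inv_mul_eq_div]
  refine ⟨(√(m : ℝ))⁻¹ • signMap ω, fun v hv => ?_, fun k t ht => ?_⟩
  · rw [hA, div_le_iff₀ hm']
    have := hω (Sum.inl ⟨v, hv⟩)
    simp only [Sum.elim_inl] at this
    linarith
  · rcases k with _ | k
    · simp
    by_cases hk : k < K
    · rw [hA, le_div_iff₀ hm']
      have := hω (Sum.inr ⟨⟨k, hk⟩, fun j => ⟨t j, ht j⟩⟩)
      simp only [Sum.elim_inr] at this
      push_cast
      linarith
    · have h1 : 1 / η ^ 2 ≤ ((k + 1 : ℕ) : ℝ) := by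
        push_cast
        refine (Nat.lt_floor_add_one (1 / η ^ 2)).le.trans ?_
        have : (K : ℝ) ≤ k := by exact_mod_cast not_lt.1 hk
        linarith
      have h2 : 1 / η ≤ √((k + 1 : ℕ) : ℝ) := by
        apply Real.le_sqrt_of_sq_le
        rwa [div_pow, one_pow]
      have h3 : 1 ≤ η * √((k + 1 : ℕ) : ℝ) := by
        rw [div_le_iff₀ hη0] at h2; linarith
      have h4 := sq_nonneg ‖∑ j, t j‖
      have h5 := sq_nonneg ‖((√(m : ℝ))⁻¹ • signMap ω) (∑ j, t j)‖
      nlinarith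

theorem sum_weights_norm_add_sq {ι E : Type*} [Fintype ι] [NormedAddCommGroup E]
    [InnerProductSpace ℝ E] (p : ι → ℝ) (hp : ∑ i, p i = 1) (w : ι → E) (x : E) :
    ∑ i, p i * ‖x + w i‖ ^ 2 =
      ‖x + ∑ i, p i • w i‖ ^ 2 + (∑ i, p i * ‖w i‖ ^ 2 - ‖∑ i, p i • w i‖ ^ 2) := by
  simp_rw [norm_add_sq_real, mul_add, Finset.sum_add_distrib]
  rw [← Finset.sum_mul, hp, inner_sum, Finset.mul_sum]
  simp_rw [inner_smul_right]
  have : ∑ i, p i * (2 * ⟪x, w i⟫) = ∑ i, 2 * (p i * ⟪x, w i⟫) :=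
    Finset.sum_congr rfl fun i _ => by ring
  rw [this]
  ring

/-- A derandomised form of Maurey's empirical method for a quadratic form. -/
theorem exists_sum_le_of_weights {ι E F : Type*} [Fintype ι] [NormedAddCommGroup E]
    [InnerProductSpace ℝ E] [NormedAddCommGroup F] [InnerProductSpace ℝ F] (A : E →ₗ[ℝ] F)
    (b : ℝ) (p : ι → ℝ) (hp0 : ∀ i, 0 ≤ p i) (hp : ∑ i, p i = 1) (w : ι → E) (k : ℕ) (x : E) :
    ∃ t : Fin k → ι, ‖A (x + ∑ j, w (t j))‖ ^ 2 - b * ‖x + ∑ j, w (t j)‖ ^ 2 ≤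
      ‖A (x + (k : ℝ) • ∑ i, p i • w i)‖ ^ 2 - b * ‖x + (k : ℝ) • ∑ i, p i • w i‖ ^ 2 +
      k * (∑ i, p i * (‖A (w i)‖ ^ 2 - b * ‖w i‖ ^ 2) -
        (‖A (∑ i, p i • w i)‖ ^ 2 - b * ‖∑ i, p i • w i‖ ^ 2)) := by
  set z := ∑ i, p i • w i with hz
  induction k generalizing x with
  | zero => exact ⟨Fin.elim0, by simp⟩
  | succ k ih =>
    set R : E → ℝ := fun y => ‖A y‖ ^ 2 - b * ‖y‖ ^ 2 with hR
    have havg : ∑ i, p i * R (x + (k : ℝ) • z + w i) =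
        R (x + (k : ℝ) • z + z) + (∑ i, p i * R (w i) - R z) := by
      have h1 := sum_weights_norm_add_sq p hp w (x + (k : ℝ) • z)
      have h2 := sum_weights_norm_add_sq p hp (fun i => A (w i)) (A (x + (k : ℝ) • z))
      have h3 : ∑ i, p i • A (w i) = A z := by simp [hz, map_sum]
      rw [h3] at h2
      rw [← hz] at h1
      simp_rw [← map_add] at h2
      simp only [hR, mul_sub, Finset.sum_sub_distrib, mul_left_comm _ b, ← Finset.mul_sum]
      rw [h1, h2]; ring
    obtain ⟨i, hi⟩ : ∃ i, R (x + (k : ℝ) • z + w i) ≤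
        R (x + (k : ℝ) • z + z) + (∑ i, p i * R (w i) - R z) := by
      by_contra! hcon
      set M := R (x + (k : ℝ) • z + z) + (∑ i, p i * R (w i) - R z) with hM
      obtain ⟨i₀, -, hi₀⟩ : ∃ i ∈ Finset.univ, 0 < p i :=
        Finset.exists_lt_of_sum_lt (by simp [hp])
      have : ∑ i, p i * M < ∑ i, p i * R (x + (k : ℝ) • z + w i) :=
        Finset.sum_lt_sum (fun i _ => mul_le_mul_of_nonneg_left (hcon i).le (hp0 i))
          ⟨i₀, Finset.mem_univ _, mul_lt_mul_of_pos_left (hcon i₀) hi₀⟩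
      rw [← Finset.sum_mul, hp, havg, one_mul] at this
      exact lt_irrefl _ this
    obtain ⟨t, ht⟩ := ih (x + w i)
    refine ⟨Fin.cons i t, ?_⟩
    have e1 : x + ∑ j, w ((Fin.cons i t : Fin (k + 1) → ι) j) = x + w i + ∑ j, w (t j) := by
      simp [Fin.sum_univ_succ, add_assoc]
    have e2 : x + ((k + 1 : ℕ) : ℝ) • z = x + (k : ℝ) • z + z := by
      push_cast; rw [add_smul, one_smul, add_assoc]
    have e3 : x + w i + (k : ℝ) • z = x + (k : ℝ) • z + w i := by abel
    rw [e1, e2]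
    rw [e3] at ht
    simp only [hR] at hi
    push_cast
    linarith

/-- Lower bound on a convex hull from lower bounds on empirical sums. -/
theorem norm_convex_comb_le {ι E F : Type*} [Fintype ι] [NormedAddCommGroup E]
    [InnerProductSpace ℝ E] [NormedAddCommGroup F] [InnerProductSpace ℝ F] (A : E →ₗ[ℝ] F)
    (T : Set E) (η : ℝ) (hη : 0 < η) (hT : ∀ v ∈ T, ‖v‖ ≤ 1)
    (hup : ∀ v ∈ T, ‖A v‖ ^ 2 ≤ (1 + η) * ‖v‖ ^ 2)
    (hlow : ∀ (k : ℕ) (t : Fin k → E), (∀ j, t j ∈ T) →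
      (1 - η * √k) * ‖∑ j, t j‖ ^ 2 ≤ ‖A (∑ j, t j)‖ ^ 2)
    (p : ι → ℝ) (hp0 : ∀ i, 0 ≤ p i) (hp : ∑ i, p i = 1) (w : ι → E) (hw : ∀ i, w i ∈ T) :
    ‖∑ i, p i • w i‖ ≤ ‖A (∑ i, p i • w i)‖ + 5 * η := by
  set z := ∑ i, p i • w i with hz
  set r := ‖z‖ with hr
  have hr1 : r ≤ 1 := by
    calc r ≤ ∑ i, ‖p i • w i‖ := norm_sum_le _ _
      _ ≤ ∑ i, p i := Finset.sum_le_sum fun i _ => by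
          rw [norm_smul, Real.norm_of_nonneg (hp0 i)]
          exact mul_le_of_le_one_right (hp0 i) (hT _ (hw i))
      _ = 1 := hp
  rcases le_or_gt r (5 * η) with hsmall | hbig
  · linarith [norm_nonneg (A z)]
  have hr0 : 0 < r := by linarith
  obtain ⟨k, hk1, hk2⟩ : ∃ k : ℕ, 1 / r ^ 2 ≤ (k : ℝ) - 1 ∧ (k : ℝ) ≤ 4 / r ^ 2 := by
    refine ⟨⌈1 / r ^ 2⌉₊ + 1, ?_, ?_⟩
    · push_cast; linarith [Nat.le_ceil (1 / r ^ 2)]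
    · have h1 := Nat.ceil_lt_add_one (a := 1 / r ^ 2) (by positivity)
      have h2 : 1 ≤ 1 / r ^ 2 := by rw [le_div_iff₀ (by positivity)]; nlinarith
      push_cast
      have : 4 / r ^ 2 = 4 * (1 / r ^ 2) := by ring
      linarith
  set δ := η * √k with hδ
  have hδ0 : 0 ≤ δ := by positivity
  have hδr : δ * r ≤ 2 * η := by
    have : √(k : ℝ) ≤ 2 / r := by
      rw [Real.sqrt_le_left (by positivity)]
      refine hk2.trans (le_of_eq ?_)
      rw [div_pow]; norm_num
    have h3 : √(k : ℝ) * r ≤ 2 := by rwa [le_div_iff₀ hr0] at this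
    rw [hδ, mul_assoc]
    nlinarith
  obtain ⟨t, ht⟩ := exists_sum_le_of_weights A (1 - δ) p hp0 hp w k 0
  have hnon := hlow k (fun j => w (t j)) (fun j => hw _)
  simp only [zero_add, map_smul, norm_smul, mul_pow] at ht
  rw [← hz] at ht
  have hsum : ∑ i, p i * (‖A (w i)‖ ^ 2 - (1 - δ) * ‖w i‖ ^ 2) ≤ η + δ := by
    calc _ ≤ ∑ i, p i * (η + δ) := by
          refine Finset.sum_le_sum fun i _ => mul_le_mul_of_nonneg_left ?_ (hp0 i)
          have h1 := hup _ (hw i)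
          have h2 : ‖w i‖ ^ 2 ≤ 1 := pow_le_one₀ (norm_nonneg _) (hT _ (hw i))
          nlinarith
      _ = η + δ := by rw [← Finset.sum_mul, hp, one_mul]
  set Q := ‖A z‖ ^ 2 - (1 - δ) * r ^ 2 with hQ
  have hk0 : (0 : ℝ) < k := by have : 0 < 1 / r ^ 2 := by positivity
                               linarith
  have hmain : 0 ≤ ((k : ℝ) - 1) * Q + (η + δ) := by
    have : 0 ≤ (k : ℝ) * (((k : ℝ) - 1) * Q + (η + δ)) := by
      rw [Real.norm_of_nonneg hk0.le, ← hr] at ht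
      have := mul_le_mul_of_nonneg_left hsum hk0.le
      rw [hQ]
      nlinarith
    exact nonneg_of_mul_nonneg_right this hk0
  have hQlow : -((η + δ) * r ^ 2) ≤ Q := by
    by_contra! hcon
    have hQneg : Q < 0 := hcon.trans_le (by simp only [Left.neg_nonpos_iff]; positivity)
    have h1 : ((k : ℝ) - 1) * Q ≤ 1 / r ^ 2 * Q := mul_le_mul_of_nonpos_right hk1 hQneg.le
    have h2 : 1 / r ^ 2 * Q < -(η + δ) := by
      rw [one_div_mul_eq_div, div_lt_iff₀ (by positivity)]; linarith
    linarith
  have hsq : (r - 5 * η) ^ 2 ≤ ‖A z‖ ^ 2 := by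
    have h1 : δ * r ^ 2 ≤ 2 * η * r := by nlinarith
    have h2 : η * r ^ 2 ≤ η * r := by
      refine mul_le_mul_of_nonneg_left ?_ hη.le
      nlinarith
    rw [hQ] at hQlow
    nlinarith
  linarith [(abs_le.1 (abs_le_of_sq_le_sq hsq (norm_nonneg _))).2]

theorem norm_sum_smul_le {ι E F : Type*} [Fintype ι] [NormedAddCommGroup E]
    [InnerProductSpace ℝ E] [NormedAddCommGroup F] [InnerProductSpace ℝ F] (A : E →ₗ[ℝ] F)
    (T : Set E) (η : ℝ) (hη : 0 < η) (hT : ∀ v ∈ T, ‖v‖ ≤ 1) (hneg : ∀ v ∈ T, -v ∈ T)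
    (hup : ∀ v ∈ T, ‖A v‖ ^ 2 ≤ (1 + η) * ‖v‖ ^ 2)
    (hlow : ∀ (k : ℕ) (t : Fin k → E), (∀ j, t j ∈ T) →
      (1 - η * √k) * ‖∑ j, t j‖ ^ 2 ≤ ‖A (∑ j, t j)‖ ^ 2)
    (c : ι → ℝ) (w : ι → E) (hw : ∀ i, w i ∈ T) :
    ‖∑ i, c i • w i‖ ≤ ‖A (∑ i, c i • w i)‖ + 5 * η * ∑ i, |c i| := by
  set S := ∑ i, |c i| with hS
  have hS0 : 0 ≤ S := Finset.sum_nonneg fun i _ => abs_nonneg _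
  rcases hS0.eq_or_lt with h0 | hpos
  · have hc : ∀ i, c i = 0 := by
      intro i
      have := (Finset.sum_eq_zero_iff_of_nonneg fun i _ => abs_nonneg (c i)).1 h0.symm i
        (Finset.mem_univ i)
      simpa using this
    simp [hc, ← h0]
  set w' : ι → E := fun i => if 0 ≤ c i then w i else -w i with hw'
  have hmem : ∀ i, w' i ∈ T := by
    intro i
    simp only [hw']
    split_ifs
    exacts [hw i, hneg _ (hw i)]
  have hz : ∑ i, (|c i| / S) • w' i = S⁻¹ • ∑ i, c i • w i := by
    rw [Finset.smul_sum]
    refine Finset.sum_congr rfl fun i _ => ?_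
    simp only [hw']
    split_ifs with h
    · rw [abs_of_nonneg h, smul_smul, div_eq_inv_mul]
    · rw [abs_of_neg (not_le.1 h), smul_smul, div_eq_inv_mul, smul_neg, mul_neg, neg_smul, neg_neg]
  have h := norm_convex_comb_le A T η hη hT hup hlow (fun i => |c i| / S)
    (fun i => by positivity) (by rw [← Finset.sum_div, div_self hpos.ne']) w' hmem
  rw [hz, map_smul, norm_smul, norm_smul, Real.norm_of_nonneg (by positivity)] at h
  have := mul_le_mul_of_nonneg_left h hS0
  rw [mul_add, mul_inv_cancel_left₀ hpos.ne', mul_inv_cancel_left₀ hpos.ne'] at this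
  linarith

/-- By convex duality, lower bounds on the norms of the images of linear combinations of the
vectors `v` let one match the inner products of the `v i` with `w` by those of the images. -/
theorem exists_inner_approx {ι E F : Type*} [Fintype ι] [NormedAddCommGroup E]
    [InnerProductSpace ℝ E] [NormedAddCommGroup F] [InnerProductSpace ℝ F]
    [FiniteDimensional ℝ F] (A : E →ₗ[ℝ] F) (v : ι → E) {κ : ℝ} (hκ0 : 0 ≤ κ)
    (h : ∀ c : ι → ℝ, ‖∑ i, c i • v i‖ ≤ ‖A (∑ i, c i • v i)‖ + κ * ∑ i, |c i|) (w : E) :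
    ∃ u : F, ‖u‖ ≤ ‖w‖ ∧ ∀ i, |⟪u, A (v i)⟫ - ⟪w, v i⟫| ≤ κ * ‖w‖ := by
  classical
  set L : F →ₗ[ℝ] (ι → ℝ) :=
    LinearMap.pi fun i => (innerₗ F (A (v i))) with hL
  set P : Set (ι → ℝ) := L '' Metric.closedBall 0 ‖w‖ with hP
  set B : Set (ι → ℝ) :=
    Set.Icc (fun i => ⟪w, v i⟫ - κ * ‖w‖) (fun i => ⟪w, v i⟫ + κ * ‖w‖) with hB
  by_cases hdisj : Disjoint P B
  · exfalso
    obtain ⟨f, a, b, hfa, hab, hfb⟩ := geometric_hahn_banach_compact_closed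
      ((convex_closedBall 0 ‖w‖).linear_image L)
      ((isCompact_closedBall 0 ‖w‖).image (LinearMap.continuous_of_finiteDimensional L))
      (convex_Icc _ _) isClosed_Icc hdisj
    set c : ι → ℝ := fun i => f (Pi.single i 1) with hc
    have hf : ∀ p : ι → ℝ, f p = ∑ i, p i * c i := by
      intro p
      have := LinearMap.pi_apply_eq_sum_univ (f : (ι → ℝ) →ₗ[ℝ] ℝ) p
      rw [ContinuousLinearMap.coe_coe] at this
      rw [this]
      refine Finset.sum_congr rfl fun i _ => ?_
      rw [smul_eq_mul, hc]
      dsimp only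
      congr 2
      ext j
      simp [Pi.single_apply, eq_comm]
    set z := ∑ i, c i • v i with hz
    have hfL : ∀ u : F, f (L u) = ⟪A z, u⟫ := by
      intro u
      rw [hf, hz, map_sum, sum_inner]
      refine Finset.sum_congr rfl fun i _ => ?_
      simp [hL, real_inner_smul_left, mul_comm]
    have h1 : ‖w‖ * ‖A z‖ < a := by
      rcases eq_or_ne (A z) 0 with h0 | h0
      · have := hfa (L 0) ⟨0, by simp, rfl⟩
        simpa [hfL, h0] using this
      · have hn : ‖A z‖ ≠ 0 := norm_ne_zero_iff.2 h0
        have := hfa (L ((‖w‖ / ‖A z‖) • A z)) ⟨_, by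
          rw [mem_closedBall_zero_iff, norm_smul, norm_div, norm_norm, norm_norm,
            div_mul_cancel₀ _ hn], rfl⟩
        rw [hfL, real_inner_smul_right, real_inner_self_eq_norm_sq] at this
        convert this using 1
        field_simp
    have h2 : b < ⟪w, z⟫ - κ * ‖w‖ * ∑ i, |c i| := by
      have hκ : 0 ≤ κ * ‖w‖ := by positivity
      have := hfb (fun i => ⟪w, v i⟫ - κ * ‖w‖ * SignType.sign (c i)) (by
        constructor <;> intro i <;> 
          rcases lt_trichotomy (c i) 0 with hi | hi | hi <;> simp [hi] <;> linarith)
      rw [hf] at this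
      refine this.trans_eq ?_
      rw [hz, inner_sum, Finset.mul_sum, ← Finset.sum_sub_distrib]
      refine Finset.sum_congr rfl fun i _ => ?_
      rw [real_inner_smul_right, sub_mul, mul_assoc _ _ (c i), sign_mul_self]
      ring
    have h3 := real_inner_le_norm w z
    have h4 := mul_le_mul_of_nonneg_left (h c) (norm_nonneg w)
    rw [← hz] at h4
    nlinarith
  · obtain ⟨_, ⟨u, hu, rfl⟩, hu2⟩ := Set.not_disjoint_iff.1 hdisj
    refine ⟨u, by simpa using hu, fun i => ?_⟩
    have h1 := hu2.1 i
    have h2 := hu2.2 i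
    simp only [hL, LinearMap.pi_apply, innerₗ_apply_apply] at h1 h2
    rw [real_inner_comm u] at h1 h2
    rw [abs_le]
    constructor <;> linarith

/-- Append one coordinate to a Euclidean vector. -/
noncomputable def euclideanSnoc {m : ℕ} (u : EuclideanSpace ℝ (Fin m)) (a : ℝ) :
    EuclideanSpace ℝ (Fin (m + 1)) :=
  WithLp.toLp 2 (Fin.snoc (α := fun _ => ℝ) u a)

theorem norm_sq_euclideanSnoc_sub {m : ℕ} (u v : EuclideanSpace ℝ (Fin m)) (a b : ℝ) :
    ‖euclideanSnoc u a - euclideanSnoc v b‖ ^ 2 = ‖u - v‖ ^ 2 + (a - b) ^ 2 := by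
  rw [EuclideanSpace.real_norm_sq_eq, EuclideanSpace.real_norm_sq_eq, Fin.sum_univ_castSucc]
  simp [euclideanSnoc]

/-- If `A` almost preserves the distances in `X` and inner products with differences of points of
`X` can be matched after applying `A`, then every point has an image at almost the right distance
from the embedded copy of `X`. -/
theorem exists_terminal_point {m N : ℕ} {X : Set (EuclideanSpace ℝ (Fin N))} (hX : X.Finite)
    (hne : X.Nonempty) {ε : ℝ} (hε0 : 0 < ε) (hε1 : ε < 1)
    (A : EuclideanSpace ℝ (Fin N) →ₗ[ℝ] EuclideanSpace ℝ (Fin m))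
    (hA : ∀ x ∈ X, ∀ y ∈ X, |‖A (x - y)‖ ^ 2 - ‖x - y‖ ^ 2| ≤ ε / 24 * ‖x - y‖ ^ 2)
    (hdual : ∀ w : EuclideanSpace ℝ (Fin N), ∃ u : EuclideanSpace ℝ (Fin m), ‖u‖ ≤ ‖w‖ ∧
      ∀ x ∈ X, ∀ y ∈ X, |⟪u, A (x - y)⟫ - ⟪w, x - y⟫| ≤ 5 * (ε / 24) * ‖w‖ * ‖x - y‖)
    (y : EuclideanSpace ℝ (Fin N)) :
    ∃ q : EuclideanSpace ℝ (Fin (m + 1)), ∀ x ∈ X,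
      (1 - ε) * ‖x - y‖ ≤ ‖euclideanSnoc (A x) 0 - q‖ ∧
        ‖euclideanSnoc (A x) 0 - q‖ ≤ (1 + ε) * ‖x - y‖ := by
  obtain ⟨x₀, hx₀, hmin⟩ := Set.exists_min_image X (fun x => ‖x - y‖) hX hne
  obtain ⟨u, hu, hin⟩ := hdual (y - x₀)
  refine ⟨euclideanSnoc (A x₀ + u) √(‖y - x₀‖ ^ 2 - ‖u‖ ^ 2), fun x hx => ?_⟩
  have hq := norm_sq_euclideanSnoc_sub (A x) (A x₀ + u) 0 √(‖y - x₀‖ ^ 2 - ‖u‖ ^ 2)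
  have hu2 : ‖u‖ ^ 2 ≤ ‖y - x₀‖ ^ 2 := by gcongr
  rw [zero_sub, neg_sq, Real.sq_sqrt (by linarith), ← sub_sub, ← map_sub,
    norm_sub_sq_real (A (x - x₀))] at hq
  have hs : ‖x - y‖ ^ 2 = ‖x - x₀‖ ^ 2 - 2 * ⟪y - x₀, x - x₀⟫ + ‖y - x₀‖ ^ 2 := by
    rw [real_inner_comm, ← norm_sub_sq_real, sub_sub_sub_cancel_right]
  have h1 := abs_le.1 (hA x hx x₀ hx₀)
  have h2 := abs_le.1 (hin x hx x₀ hx₀)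
  rw [real_inner_comm u] at hq
  set Q := ‖euclideanSnoc (A x) 0 - euclideanSnoc (A x₀ + u) √(‖y - x₀‖ ^ 2 - ‖u‖ ^ 2)‖
  have hD : ‖y - x₀‖ ≤ ‖x - y‖ := by rw [norm_sub_rev]; exact hmin x hx
  have ha : ‖x - x₀‖ ≤ 2 * ‖x - y‖ := by
    have := norm_sub_le_norm_sub_add_norm_sub x y x₀
    linarith
  set s := ‖x - y‖
  set a := ‖x - x₀‖
  set D := ‖y - x₀‖
  have hs0 : 0 ≤ s := norm_nonneg _
  have ha0 : 0 ≤ a := norm_nonneg _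
  have hD0 : 0 ≤ D := norm_nonneg _
  have hQ0 : 0 ≤ Q := norm_nonneg _
  have ha2 : a ^ 2 ≤ 4 * s ^ 2 := by nlinarith
  have hDa : D * a ≤ 2 * s ^ 2 := by nlinarith
  have b1 : ε / 24 * a ^ 2 ≤ ε / 6 * s ^ 2 := by nlinarith
  have b2 : 5 * (ε / 24) * D * a ≤ 5 * (ε / 12) * s ^ 2 := by nlinarith
  have hs2 : 0 ≤ ε * s ^ 2 := by positivity
  constructor
  · refine le_of_sq_le_sq ?_ hQ0
    nlinarith [mul_nonneg (mul_nonneg hε0.le (sub_nonneg.2 hε1.le)) (sq_nonneg s)]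
  · refine le_of_sq_le_sq ?_ (by positivity)
    nlinarith [mul_nonneg (mul_nonneg hε0.le hε0.le) (sq_nonneg s)]

theorem exists_terminal_embedding {m N : ℕ} (hm : 0 < m) {X : Set (EuclideanSpace ℝ (Fin N))}
    (hX : X.Finite) (hne : X.Nonempty) {ε : ℝ} (hε0 : 0 < ε) (hε1 : ε < 1)
    (hcard : 4 * (X.ncard : ℝ) ^ 2 ≤ Real.exp (m * (ε / 24) ^ 2 / 32)) :
    ∃ f : EuclideanSpace ℝ (Fin N) → EuclideanSpace ℝ (Fin (m + 1)),
      ∀ x ∈ X, ∀ y : EuclideanSpace ℝ (Fin N),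
        (1 - ε) * ‖x - y‖ ≤ ‖f x - f y‖ ∧ ‖f x - f y‖ ≤ (1 + ε) * ‖x - y‖ := by
  classical
  set g : EuclideanSpace ℝ (Fin N) × EuclideanSpace ℝ (Fin N) → EuclideanSpace ℝ (Fin N) :=
    fun p => ‖p.1 - p.2‖⁻¹ • (p.1 - p.2) with hg
  set T := (hX.toFinset ×ˢ hX.toFinset).image g with hT
  have hmem : ∀ x ∈ X, ∀ y ∈ X, g (x, y) ∈ T := fun x hx y hy =>
    Finset.mem_image_of_mem _ (by simp [hx, hy])
  have hrep : ∀ x y, ‖x - y‖ • g (x, y) = x - y := by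
    intro x y
    rcases eq_or_ne (x - y) 0 with h | h
    · simp [hg, h]
    · rw [hg, smul_inv_smul₀ (norm_ne_zero_iff.2 h)]
  have hTcard : (T.card : ℝ) ≤ (X.ncard : ℝ) ^ 2 := by
    rw [Set.ncard_eq_toFinset_card X hX, sq]
    exact_mod_cast Finset.card_image_le.trans (Finset.card_product _ _).le
  have hT1 : ∀ v ∈ T, ‖v‖ ≤ 1 := by
    intro v hv
    obtain ⟨p, -, rfl⟩ := Finset.mem_image.1 hv
    rw [hg, norm_smul, norm_inv, norm_norm]
    exact inv_mul_le_one
  have hTneg : ∀ v ∈ T, -v ∈ T := by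
    intro v hv
    obtain ⟨⟨x, y⟩, hp, rfl⟩ := Finset.mem_image.1 hv
    simp only [Finset.mem_product, Set.Finite.mem_toFinset] at hp
    convert hmem y hp.2 x hp.1 using 1
    simp only [hg]
    rw [← smul_neg, neg_sub, norm_sub_rev]
  obtain ⟨A, hup, hlow⟩ := exists_linearMap_norm_sq_bounds hm T (η := ε / 24) (by positivity)
    (by linarith) (by linarith)
  have hpt := exists_terminal_point hX hne hε0 hε1 A
    (by
      intro x hx y hy
      have h1 := hup _ (hmem x hx y hy)
      have h2 := hlow 1 (fun _ => g (x, y)) (fun _ => hmem x hx y hy)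
      simp only [Finset.univ_unique, Finset.sum_const, Finset.card_singleton, one_smul,
        Nat.cast_one, Real.sqrt_one, mul_one] at h2
      have h3 := mul_le_mul_of_nonneg_left h1 (sq_nonneg ‖x - y‖)
      have h4 := mul_le_mul_of_nonneg_left h2 (sq_nonneg ‖x - y‖)
      have e1 : ‖A (x - y)‖ ^ 2 = ‖x - y‖ ^ 2 * ‖A (g (x, y))‖ ^ 2 := by
        conv_lhs => rw [← hrep x y, map_smul, norm_smul, norm_norm, mul_pow]
      have e2 : ‖x - y‖ ^ 2 = ‖x - y‖ ^ 2 * ‖g (x, y)‖ ^ 2 := by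
        conv_lhs => rw [← hrep x y, norm_smul, norm_norm, mul_pow]
      rw [abs_le]
      constructor <;> nlinarith)
    (by
      intro w
      obtain ⟨u, hu, hin⟩ := exists_inner_approx A (fun v : T => v.1)
        (κ := 5 * (ε / 24)) (by positivity)
        (fun c => norm_sum_smul_le A T (ε / 24) (by positivity) hT1 hTneg hup hlow c _
          (fun v => v.2)) w
      refine ⟨u, hu, fun x hx y hy => ?_⟩
      have h := mul_le_mul_of_nonneg_right (hin ⟨_, hmem x hx y hy⟩) (norm_nonneg (x - y))
      rw [← abs_norm (x - y), ← abs_mul, abs_norm, sub_mul] at h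
      conv_lhs => rw [← hrep x y, map_smul, inner_smul_right, inner_smul_right]
      rwa [mul_comm ‖x - y‖, mul_comm ‖x - y‖])
  choose f hf using hpt
  refine ⟨f, fun x hx y => ?_⟩
  have h0 := (hf x x hx).2
  rw [sub_self, norm_zero, mul_zero] at h0
  rw [← sub_eq_zero.1 (norm_le_zero_iff.1 h0)]
  exact hf y x hx

theorem stmt_8 :
    ∃ C : ℝ, 0 < C ∧ ∀ (N : ℕ) (X : Set (EuclideanSpace ℝ (Fin N))), X.Finite →
      1 < X.ncard → ∀ ε : ℝ, ε ∈ Set.Ioo (0 : ℝ) 1 →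
      ∃ m : ℕ, (m : ℝ) ≤ C * ε⁻¹ ^ 2 * Real.log X.ncard ∧
      ∃ f : EuclideanSpace ℝ (Fin N) → EuclideanSpace ℝ (Fin m),
        ∀ x ∈ X, ∀ y : EuclideanSpace ℝ (Fin N),
          (1 - ε) * ‖x - y‖ ≤ ‖f x - f y‖ ∧ ‖f x - f y‖ ≤ (1 + ε) * ‖x - y‖ := by
  refine ⟨73732, by norm_num, fun N X hX hn ε ⟨hε0, hε1⟩ => ?_⟩
  have hn2 : (2 : ℝ) ≤ X.ncard := by exact_mod_cast hn
  have hlog : 1 / 2 ≤ Real.log X.ncard := by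
    have := Real.log_le_log (by norm_num) hn2
    linarith [Real.log_two_gt_d9]
  have hε : 1 ≤ ε⁻¹ ^ 2 := one_le_pow₀ (one_le_inv₀ hε0 |>.2 hε1.le)
  set L := ε⁻¹ ^ 2 * Real.log X.ncard with hL
  have hL1 : 1 / 2 ≤ L := by nlinarith
  have hεL : L * ε ^ 2 = Real.log X.ncard := by rw [hL]; field_simp
  have hceil := Nat.le_ceil (73728 * L)
  refine ⟨⌈73728 * L⌉₊ + 1, ?_, exists_terminal_embedding (Nat.ceil_pos.2 (by linarith)) hX
    (Set.nonempty_of_ncard_ne_zero (by omega)) hε0 hε1 ?_⟩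
  · have := Nat.ceil_lt_add_one (a := 73728 * L) (by linarith)
    push_cast
    rw [mul_assoc, ← hL]
    linarith
  · have hn4 : (4 : ℝ) ≤ (X.ncard : ℝ) ^ 2 := by nlinarith
    calc 4 * (X.ncard : ℝ) ^ 2 ≤ (X.ncard : ℝ) ^ 4 := by nlinarith
      _ = Real.exp (4 * Real.log X.ncard) := by
          rw [mul_comm, Real.exp_mul, Real.exp_log (by linarith)]
          norm_cast
      _ ≤ _ := by
          rw [Real.exp_le_exp, ← hεL]
          nlinarith [sq_nonneg ε]
end

section
/- Let M ⊆ ℝ^N be nonempty, let ε ∈ (0,1), and let f : ℝ^N → ℝ^m be a terminal embedding of M with distortion ε. Let δ > 0 and let T ⊆ tube(δ,M) be a nonempty set such that M ⊆ tube(δ,T) (i.e., T is a δ-external cover of M). Then for every z ∈ ℝ^N, |inf_{t∈T} ‖f(z)−f(t)‖₂ − d(z,M)| ≤ ε·d(z,M) + 3(1+ε)δ, where d(z,M) := inf_{y∈M} ‖z−y‖₂. -/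
open MeasureTheory ProbabilityTheory
open scoped RealInnerProductSpace

/-- The tube of radius `δ` around `M`. -/
def tube {N : ℕ} (δ : ℝ) (M : Set (EuclideanSpace ℝ (Fin N))) :
    Set (EuclideanSpace ℝ (Fin N)) :=
  {x | ∃ y ∈ M, ‖x - y‖ ≤ δ}

theorem stmt_11 {N m : ℕ} (M : Set (EuclideanSpace ℝ (Fin N))) (hM : M.Nonempty)
    (ε : ℝ) (hε : ε ∈ Set.Ioo (0 : ℝ) 1)
    (f : EuclideanSpace ℝ (Fin N) → EuclideanSpace ℝ (Fin m))
    (hf : ∀ x ∈ M, ∀ y : EuclideanSpace ℝ (Fin N),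
      (1 - ε) * ‖x - y‖ ≤ ‖f x - f y‖ ∧ ‖f x - f y‖ ≤ (1 + ε) * ‖x - y‖)
    (δ : ℝ) (hδ : 0 < δ) (T : Set (EuclideanSpace ℝ (Fin N))) (hT : T.Nonempty)
    (hTsub : T ⊆ tube δ M) (hTcov : M ⊆ tube δ T) (z : EuclideanSpace ℝ (Fin N)) :
    |sInf ((fun t => ‖f z - f t‖) '' T) - Metric.infDist z M| ≤
      ε * Metric.infDist z M + 3 * (1 + ε) * δ := by
  obtain ⟨hε0, hε1⟩ := hε
  set S := sInf ((fun t => ‖f z - f t‖) '' T)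
  have hd : 0 ≤ Metric.infDist z M := Metric.infDist_nonneg
  have hεδ : 0 ≤ (1 + ε) * δ := by positivity
  have lower : (1 - ε) * Metric.infDist z M - (1 + ε) * δ ≤ S := by
    refine le_csInf (hT.image _) ?_
    rintro _ ⟨t, ht, rfl⟩
    obtain ⟨y, hy, hty⟩ := hTsub ht
    have hzy : Metric.infDist z M ≤ ‖y - z‖ := by
      simpa [dist_eq_norm, norm_sub_rev] using Metric.infDist_le_dist_of_mem (x := z) hy
    have hfz : (1 - ε) * Metric.infDist z M ≤ ‖f y - f z‖ :=
      (mul_le_mul_of_nonneg_left hzy (by linarith)).trans (hf y hy z).1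
    have hft : ‖f y - f t‖ ≤ (1 + ε) * δ := by
      rw [norm_sub_rev] at hty
      exact (hf y hy t).2.trans (mul_le_mul_of_nonneg_left hty (by linarith))
    have tri := norm_sub_le_norm_sub_add_norm_sub (f y) (f t) (f z)
    rw [norm_sub_rev (f t) (f z)] at tri
    show _ ≤ ‖f z - f t‖
    linarith
  have upper : S ≤ (1 + ε) * Metric.infDist z M + (1 + ε) * δ := by
    have key : (S - (1 + ε) * δ) / (1 + ε) ≤ Metric.infDist z M := by
      refine (Metric.le_infDist hM).2 fun y hy => ?_
      obtain ⟨t, ht, hyt⟩ := hTcov hy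
      have hSt : S ≤ ‖f z - f t‖ :=
        csInf_le ⟨0, by rintro _ ⟨u, -, rfl⟩; exact norm_nonneg _⟩ ⟨t, ht, rfl⟩
      have hft : ‖f y - f t‖ ≤ (1 + ε) * δ :=
        (hf y hy t).2.trans (mul_le_mul_of_nonneg_left hyt (by linarith))
      have hfz := (hf y hy z).2
      have tri := norm_sub_le_norm_sub_add_norm_sub (f z) (f y) (f t)
      rw [div_le_iff₀ (by linarith), dist_eq_norm, norm_sub_rev z y]
      rw [norm_sub_rev (f z) (f y)] at tri
      linarith
    rw [div_le_iff₀ (by linarith)] at key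
    linarith
  rw [abs_le]
  constructor <;> linarith
end

section
/- Let M₁, M₂ ⊆ ℝ^N be nonempty, let ε ∈ (0,1), and let f : ℝ^N → ℝ^m be a terminal embedding of M₁ ∪ M₂ with distortion ε. Let δ > 0, set T₁ := tube(δ,M₁) and T₂ := tube(δ,M₂), and suppose inf{‖x−y‖₂ : x ∈ T₁, y ∈ T₂} > 2(1+ε)δ/(1−ε). Then for every z ∈ T₁, inf_{t∈T₁} ‖f(z)−f(t)‖₂ < inf_{t∈T₂} ‖f(z)−f(t)‖₂; that is, the compressed nearest-neighbor rule classifies every point of T₁ correctly. -/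
open MeasureTheory ProbabilityTheory
open scoped RealInnerProductSpace

theorem stmt_12 {N m : ℕ} (M₁ M₂ : Set (EuclideanSpace ℝ (Fin N)))
    (hM₁ : M₁.Nonempty) (hM₂ : M₂.Nonempty) (ε : ℝ) (hε : ε ∈ Set.Ioo (0 : ℝ) 1)
    (f : EuclideanSpace ℝ (Fin N) → EuclideanSpace ℝ (Fin m))
    (hf : ∀ x ∈ M₁ ∪ M₂, ∀ y : EuclideanSpace ℝ (Fin N),
      (1 - ε) * ‖x - y‖ ≤ ‖f x - f y‖ ∧ ‖f x - f y‖ ≤ (1 + ε) * ‖x - y‖)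
    (δ : ℝ) (hδ : 0 < δ)
    (hsep : 2 * (1 + ε) * δ / (1 - ε) <
      sInf {d : ℝ | ∃ x ∈ tube δ M₁, ∃ y ∈ tube δ M₂, d = ‖x - y‖}) :
    ∀ z ∈ tube δ M₁,
      sInf ((fun t => ‖f z - f t‖) '' tube δ M₁) <
        sInf ((fun t => ‖f z - f t‖) '' tube δ M₂) := by
  obtain ⟨hε0, hε1⟩ := hε
  have self_mem : ∀ {M : Set (EuclideanSpace ℝ (Fin N))} {x}, x ∈ M → x ∈ tube δ M :=
    fun {_ x} hx => ⟨x, hx, by simpa using hδ.le⟩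
  intro z hz
  have hle : sInf ((fun t => ‖f z - f t‖) '' tube δ M₁) ≤ 0 := by
    refine csInf_le ⟨0, ?_⟩ ⟨z, hz, by simp⟩
    rintro _ ⟨t, -, rfl⟩
    exact norm_nonneg _
  have hpos : 0 < (1 + ε) * δ := by positivity
  refine (hle.trans_lt hpos).trans_le (le_csInf ?_ ?_)
  · obtain ⟨y, hy⟩ := hM₂
    exact ⟨_, y, self_mem hy, rfl⟩
  rintro _ ⟨t, ht, rfl⟩
  obtain ⟨x, hx, hzx⟩ := hz
  have hdist : 2 * (1 + ε) * δ / (1 - ε) < ‖x - t‖ := by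
    refine hsep.trans_le (csInf_le ⟨0, ?_⟩ ⟨x, self_mem hx, t, ht, rfl⟩)
    rintro _ ⟨_, _, _, _, rfl⟩
    exact norm_nonneg _
  rw [div_lt_iff₀ (by linarith)] at hdist
  have hlower := (hf x (Or.inl hx) t).1
  have hupper := (hf x (Or.inl hx) z).2
  rw [norm_sub_rev x z] at hupper
  have hbound : (1 + ε) * ‖z - x‖ ≤ (1 + ε) * δ := by gcongr
  have htri := norm_sub_le_norm_sub_add_norm_sub (f x) (f z) (f t)
  show (1 + ε) * δ ≤ ‖f z - f t‖
  linarith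
end

section
/- There exists a universal constant C > 0 with the following property. Let M = A₁ ∪ ⋯ ∪ Aₙ ⊆ ℝ^N be a union of n ≥ 2 affine subspaces of ℝ^N, each of dimension at most d ≥ 1. Then the Gaussian width of the set of unit secants of M satisfies w(S_M) ≤ C·√(d + log n). -/
open MeasureTheory ProbabilityTheory
open scoped RealInnerProductSpace

noncomputable def gaussianWidth {N : ℕ} (A : Set (EuclideanSpace ℝ (Fin N))) : ℝ :=
  ∫ g : Fin N → ℝ, sSup ((fun a : EuclideanSpace ℝ (Fin N) => ∑ i, g i * a i) '' A)
    ∂(Measure.pi fun _ => gaussianReal 0 1)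

/-- `A` is an affine subspace of dimension at most `d`. -/
def IsAffineOfDimLE {N : ℕ} (d : ℕ) (A : Set (EuclideanSpace ℝ (Fin N))) : Prop :=
  ∃ (v : EuclideanSpace ℝ (Fin N)) (W : Submodule ℝ (EuclideanSpace ℝ (Fin N))),
    Module.finrank ℝ W ≤ d ∧ A = (fun w => v + w) '' (W : Set (EuclideanSpace ℝ (Fin N)))

/-- `x ^ 2 / 4` has an exponential moment under the standard Gaussian measure. -/
lemma integrable_exp_sq_div_four_gaussianReal :
    Integrable (fun x : ℝ => Real.exp (x ^ 2 / 4)) (gaussianReal 0 1) := by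
  rw [gaussianReal_of_var_ne_zero _ one_ne_zero,
    integrable_withDensity_iff (measurable_gaussianPDF _ _)
      (ae_of_all _ fun _ => ENNReal.ofReal_lt_top)]
  refine ((integrable_exp_neg_mul_sq (b := 1 / 4) (by norm_num)).const_mul
    (√(2 * Real.pi * (1 : NNReal)))⁻¹).congr (ae_of_all _ fun x => ?_)
  simp only [toReal_gaussianPDF, gaussianPDFReal_def]
  rw [mul_left_comm, ← Real.exp_add]
  congr 2
  simp
  ring

lemma integral_exp_sq_div_four_gaussianReal :
    ∫ x : ℝ, Real.exp (x ^ 2 / 4) ∂(gaussianReal 0 1) = √2 := by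
  rw [integral_gaussianReal_eq_integral_smul one_ne_zero]
  have h : ∀ x : ℝ, gaussianPDFReal 0 1 x • Real.exp (x ^ 2 / 4)
      = (√(2 * Real.pi))⁻¹ * Real.exp (-(1 / 4) * x ^ 2) := by
    intro x
    simp only [gaussianPDFReal_def, smul_eq_mul, mul_assoc]
    rw [← Real.exp_add]
    congr 2
    · simp
    · simp
      ring
  simp_rw [h]
  rw [integral_const_mul, integral_gaussian, ← Real.sqrt_inv, ← Real.sqrt_mul (by positivity)]
  congr 1
  field_simp [Real.pi_ne_zero]
  norm_num

lemma exp_norm_sq_sum_smul_orthonormalBasis {E : Type*} [NormedAddCommGroup E]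
    [InnerProductSpace ℝ E] {ι : Type*} [Fintype ι] (b : OrthonormalBasis ι ℝ E)
    (x : ι → ℝ) :
    Real.exp (‖∑ i, x i • b i‖ ^ 2 / 4) = ∏ i, Real.exp (x i ^ 2 / 4) := by
  rw [← b.sum_sq_norm_inner_right, Finset.sum_div, Real.exp_sum]
  refine Finset.prod_congr rfl fun i _ => ?_
  rw [b.orthonormal.inner_right_fintype, Real.norm_eq_abs, sq_abs]

section StdGaussian

variable {E : Type*} [NormedAddCommGroup E] [InnerProductSpace ℝ E] [FiniteDimensional ℝ E]
  [MeasurableSpace E] [BorelSpace E]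

lemma integrable_exp_norm_sq_div_four_stdGaussian :
    Integrable (fun y : E => Real.exp (‖y‖ ^ 2 / 4)) (stdGaussian E) := by
  rw [stdGaussian, integrable_map_measure (by fun_prop) (Measurable.aemeasurable (by fun_prop))]
  refine (Integrable.fintype_prod fun _ => integrable_exp_sq_div_four_gaussianReal).congr
    (ae_of_all _ fun x => ?_)
  exact (exp_norm_sq_sum_smul_orthonormalBasis _ x).symm

lemma integral_exp_norm_sq_div_four_stdGaussian :
    ∫ y : E, Real.exp (‖y‖ ^ 2 / 4) ∂(stdGaussian E) = √2 ^ Module.finrank ℝ E := by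
  rw [stdGaussian, integral_map (Measurable.aemeasurable (by fun_prop)) (by fun_prop)]
  simp_rw [exp_norm_sq_sum_smul_orthonormalBasis]
  rw [integral_fintype_prod_eq_prod (f := fun _ x => Real.exp (x ^ 2 / 4))]
  simp [integral_exp_sq_div_four_gaussianReal]

/-- The orthogonal projection of a standard Gaussian vector is a standard Gaussian vector. -/
lemma map_orthogonalProjectionOnto_stdGaussian (L : Submodule ℝ E) :
    (stdGaussian E).map L.orthogonalProjectionOnto = stdGaussian L := by
  have : IsProbabilityMeasure ((stdGaussian E).map L.orthogonalProjectionOnto) :=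
    Measure.isProbabilityMeasure_map (by fun_prop)
  apply Measure.ext_of_charFun
  ext t
  rw [charFun_stdGaussian, charFun_apply, integral_map (by fun_prop) (by fun_prop)]
  have h := charFun_stdGaussian (t : E)
  rw [charFun_apply] at h
  simpa using h

end StdGaussian

section Projection

variable {N : ℕ} (L : Submodule ℝ (EuclideanSpace ℝ (Fin N)))

lemma integrable_exp_norm_sq_projection_pi_gaussianReal :
    Integrable (fun g : Fin N → ℝ =>
      Real.exp (‖L.orthogonalProjectionOnto (WithLp.toLp 2 g)‖ ^ 2 / 4))
      (Measure.pi fun _ => gaussianReal 0 1) := by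
  have h := integrable_exp_norm_sq_div_four_stdGaussian (E := L)
  rw [← map_orthogonalProjectionOnto_stdGaussian, ← map_pi_eq_stdGaussian,
    integrable_map_measure (by fun_prop) (by fun_prop),
    integrable_map_measure (by fun_prop) (by fun_prop)] at h
  exact h

lemma integral_exp_norm_sq_projection_pi_gaussianReal :
    ∫ g : Fin N → ℝ, Real.exp (‖L.orthogonalProjectionOnto (WithLp.toLp 2 g)‖ ^ 2 / 4)
      ∂(Measure.pi fun _ => gaussianReal 0 1) = √2 ^ Module.finrank ℝ L := by
  rw [← integral_exp_norm_sq_div_four_stdGaussian (E := L),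
    ← map_orthogonalProjectionOnto_stdGaussian, ← map_pi_eq_stdGaussian,
    integral_map (by fun_prop) (by fun_prop), integral_map (by fun_prop) (by fun_prop)]

end Projection

/-- The unit ball of a finite union of linear subspaces of dimension at most `k` has small Gaussian
width, in the form of a bound with free parameters `a` and `t`. -/
lemma gaussianWidth_le_of_subset_iUnion_submodule {N : ℕ} {ι : Type*} [Fintype ι]
    (L : ι → Submodule ℝ (EuclideanSpace ℝ (Fin N))) {k : ℕ}
    (hL : ∀ i, Module.finrank ℝ (L i) ≤ k) (S : Set (EuclideanSpace ℝ (Fin N)))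
    (hS : ∀ u ∈ S, ‖u‖ ≤ 1 ∧ ∃ i, u ∈ L i) {a t : ℝ} (ha : 1 ≤ a)
    (hka : Fintype.card ι * √2 ^ k ≤ a) (ht : 0 < t) :
    gaussianWidth S ≤ (4 * (1 + Real.log a) / t + t) / 2 := by
  have ha0 : 0 < a := by linarith
  have hlog : 0 ≤ Real.log a := Real.log_nonneg ha
  set X : ι → (Fin N → ℝ) → ℝ := fun i g =>
    ‖(L i).orthogonalProjectionOnto (WithLp.toLp 2 g)‖ ^ 2 / 4
  set Z : (Fin N → ℝ) → ℝ := fun g => ∑ i, Real.exp (X i g) with hZ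
  have hZint : Integrable Z (Measure.pi fun _ => gaussianReal 0 1) :=
    integrable_finsetSum _ fun i _ => integrable_exp_norm_sq_projection_pi_gaussianReal (L i)
  have hZle : ∫ g, Z g ∂(Measure.pi fun _ => gaussianReal 0 1) ≤ a := by
    rw [hZ, integral_finsetSum _ fun i _ =>
      integrable_exp_norm_sq_projection_pi_gaussianReal (L i)]
    refine le_trans (Finset.sum_le_sum fun i _ => ?_) ((?_ : ∑ _i : ι, √2 ^ k = _).trans_le hka)
    · rw [integral_exp_norm_sq_projection_pi_gaussianReal]
      exact pow_le_pow_right₀ (Real.one_le_sqrt.2 one_le_two) (hL i)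
    · simp
  have hpt : ∀ g : Fin N → ℝ,
      sSup ((fun u : EuclideanSpace ℝ (Fin N) => ∑ i, g i * u i) '' S)
        ≤ (4 * (Z g / a + Real.log a) / t + t) / 2 := by
    intro g
    have hZ0 : 0 ≤ Z g := Finset.sum_nonneg fun i _ => (Real.exp_pos _).le
    refine Real.sSup_le ?_ (by positivity)
    rintro _ ⟨u, hu, rfl⟩
    obtain ⟨hu1, i, hi⟩ := hS u hu
    set p := ‖(L i).orthogonalProjectionOnto (WithLp.toLp 2 g)‖
    have h1 : ∑ j, g j * u j ≤ p := by
      have h2 : ∑ j, g j * u j = ⟪(L i).orthogonalProjectionOnto (WithLp.toLp 2 g), ⟨u, hi⟩⟫ := by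
        rw [Submodule.inner_orthogonalProjectionOnto_eq_of_mem_right]
        simp [PiLp.inner_apply, mul_comm]
      rw [h2]
      refine (real_inner_le_norm _ _).trans ?_
      exact mul_le_of_le_one_right (norm_nonneg _) hu1
    have h3 : X i g - Real.log a + 1 ≤ Z g / a := by
      refine (Real.add_one_le_exp _).trans ?_
      rw [Real.exp_sub, Real.exp_log ha0]
      gcongr
      exact Finset.single_le_sum (f := fun i => Real.exp (X i g))
        (fun i _ => (Real.exp_pos _).le) (Finset.mem_univ i)
    have h4 : p ^ 2 ≤ 4 * (Z g / a + Real.log a) := by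
      have : X i g = p ^ 2 / 4 := rfl
      linarith
    have h5 : p ≤ (p ^ 2 / t + t) / 2 := by
      have : (p ^ 2 / t + t) / 2 - p = (p - t) ^ 2 / (2 * t) := by
        field_simp
        ring
      have : 0 ≤ (p - t) ^ 2 / (2 * t) := by positivity
      linarith
    calc ∑ j, g j * u j ≤ (p ^ 2 / t + t) / 2 := h1.trans h5
      _ ≤ _ := by gcongr
  have hRint : Integrable (fun g => (4 * (Z g / a + Real.log a) / t + t) / 2)
      (Measure.pi fun _ : Fin N => gaussianReal 0 1) :=
    ((((hZint.div_const a).add (integrable_const _)).const_mul 4 |>.div_const t).add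
      (integrable_const _)).div_const 2
  have hR : ∫ g, (4 * (Z g / a + Real.log a) / t + t) / 2
      ∂(Measure.pi fun _ : Fin N => gaussianReal 0 1) ≤ (4 * (1 + Real.log a) / t + t) / 2 := by
    have h1 : Integrable (fun g => Z g / a + Real.log a)
        (Measure.pi fun _ : Fin N => gaussianReal 0 1) :=
      (hZint.div_const a).add (integrable_const _)
    rw [integral_div, integral_add ((h1.const_mul 4).div_const t) (integrable_const _),
      integral_div, integral_const_mul, integral_add (hZint.div_const a) (integrable_const _),
      integral_div]
    simp only [integral_const, probReal_univ, one_smul]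
    gcongr
    exact (div_le_one ha0).2 hZle
  unfold gaussianWidth
  by_cases hint : Integrable (fun g : Fin N → ℝ =>
      sSup ((fun u : EuclideanSpace ℝ (Fin N) => ∑ i, g i * u i) '' S))
      (Measure.pi fun _ => gaussianReal 0 1)
  · exact (integral_mono hint hRint hpt).trans hR
  · rw [integral_undef hint]
    positivity

/-- The secants of a finite union of affine subspaces lie in finitely many linear subspaces. -/
lemma exists_submodule_of_mem_unitSecants {N n d : ℕ} {A : Fin n → Set (EuclideanSpace ℝ (Fin N))}
    (hA : ∀ i, IsAffineOfDimLE d (A i)) :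
    ∃ L : Fin n × Fin n → Submodule ℝ (EuclideanSpace ℝ (Fin N)),
      (∀ p, Module.finrank ℝ (L p) ≤ 2 * d + 1) ∧
      ∀ u ∈ unitSecants (⋃ i, A i), ‖u‖ ≤ 1 ∧ ∃ p, u ∈ L p := by
  choose v W hW hAW using hA
  refine ⟨fun p => (W p.1 ⊔ W p.2) ⊔ Submodule.span ℝ {v p.1 - v p.2}, fun p => ?_, fun u hu => ?_⟩
  · have h1 := Submodule.finrank_add_le_finrank_add_finrank (W p.1 ⊔ W p.2)
      (Submodule.span ℝ {v p.1 - v p.2})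
    have h2 := Submodule.finrank_add_le_finrank_add_finrank (W p.1) (W p.2)
    have h3 : Module.finrank ℝ (Submodule.span ℝ {v p.1 - v p.2}) ≤ 1 := by
      simpa using finrank_span_le_card (R := ℝ) {v p.1 - v p.2}
    have h4 := add_le_add (hW p.1) (hW p.2)
    exact (h1.trans (add_le_add (h2.trans h4) h3)).trans_eq (by ring)
  · set L : Fin n × Fin n → Submodule ℝ (EuclideanSpace ℝ (Fin N)) :=
      fun p => (W p.1 ⊔ W p.2) ⊔ Submodule.span ℝ {v p.1 - v p.2}
    have hclosed : IsClosed (Metric.closedBall 0 1 ∩ ⋃ p, (L p : Set (EuclideanSpace ℝ (Fin N)))) :=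
      Metric.isClosed_closedBall.inter
        (isClosed_iUnion_of_finite fun p => (L p).closed_of_finiteDimensional)
    have hmem : u ∈ Metric.closedBall 0 1 ∩ ⋃ p, (L p : Set (EuclideanSpace ℝ (Fin N))) := by
      refine closure_minimal ?_ hclosed hu
      rintro _ ⟨x, hx, y, hy, hxy, rfl⟩
      obtain ⟨i, hi⟩ := Set.mem_iUnion.1 hx
      obtain ⟨j, hj⟩ := Set.mem_iUnion.1 hy
      rw [hAW] at hi hj
      obtain ⟨w, hw, rfl⟩ := hi
      obtain ⟨z, hz, rfl⟩ := hj
      refine ⟨?_, Set.mem_iUnion.2 ⟨(i, j), (L (i, j)).smul_mem _ ?_⟩⟩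
      · rw [mem_closedBall_zero_iff, norm_smul, norm_inv, norm_norm]
        exact inv_mul_le_one
      · have : (v i + w) - (v j + z) = (w - z) + (v i - v j) := by abel
        simp only [this]
        exact Submodule.add_mem_sup
          (Submodule.sub_mem _ (Submodule.mem_sup_left hw) (Submodule.mem_sup_right hz))
          (Submodule.mem_span_singleton_self _)
    exact ⟨by simpa using hmem.1, by simpa using hmem.2⟩

theorem stmt_13 :
    ∃ C : ℝ, 0 < C ∧ ∀ (N n d : ℕ), 2 ≤ n → 1 ≤ d →
      ∀ A : Fin n → Set (EuclideanSpace ℝ (Fin N)),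
      (∀ i, IsAffineOfDimLE d (A i)) →
      gaussianWidth (unitSecants (⋃ i, A i)) ≤ C * Real.sqrt (d + Real.log n) := by
  refine ⟨9, by norm_num, fun N n d hn hd A hA => ?_⟩
  obtain ⟨L, hdim, hmem⟩ := exists_submodule_of_mem_unitSecants hA
  have hd' : (1 : ℝ) ≤ d := by exact_mod_cast hd
  have hn' : (2 : ℝ) ≤ n := by exact_mod_cast hn
  have hlogn : 0 ≤ Real.log n := Real.log_nonneg (by linarith)
  have hs : 0 < d + Real.log n := by linarith
  have h2 : 1 ≤ √(2 : ℝ) := Real.one_le_sqrt.2 one_le_two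
  have ht : 0 < √(d + Real.log n) := Real.sqrt_pos.2 hs
  have key := gaussianWidth_le_of_subset_iUnion_submodule L hdim _ hmem
    (a := (n : ℝ) * n * √2 ^ (2 * d + 1))
    (one_le_mul_of_one_le_of_one_le (by nlinarith) (one_le_pow₀ h2)) (by simp) ht
  have hlog : Real.log ((n : ℝ) * n * √2 ^ (2 * d + 1)) ≤ 2 * (d + Real.log n) := by
    rw [Real.log_mul (by positivity) (by positivity), Real.log_mul (by positivity) (by positivity),
      Real.log_pow, Real.log_sqrt (by norm_num)]
    push_cast
    nlinarith [Real.log_two_lt_d9, Real.log_two_gt_d9]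
  have hsq : √(d + Real.log n) ^ 2 = d + Real.log n := Real.sq_sqrt hs.le
  have hdiv : 4 * (1 + Real.log ((n : ℝ) * n * √2 ^ (2 * d + 1))) / √(d + Real.log n)
      ≤ 12 * √(d + Real.log n) := by
    rw [div_le_iff₀ ht]
    nlinarith
  linarith
end
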